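/- Let n ≥ 1, μ > 0, α > 0, γ ≥ 0. On a probability space let ζ : ℝⁿ × Ω → ℝ be a jointly measurable random field such that every finite family (ζ(x₁),…,ζ(x_k)) is centered jointly Gaussian with E[ζ(x)²] = 1 and E[ζ(x)ζ(y)] = R(x−y), where R(z) = ∫_{ℝⁿ} e^{i⟨λ,z⟩} f(λ) dλ for a nonnegative integrable radial spectral density f that is decreasing in |λ| for |λ| > λ₀ (some λ₀ > 0) and continuous at every λ ≠ 0. Let h : ℝ → ℝ be Borel with ∫_ℝ h² dγ₁ < ∞ (γ₁ the standard Gaussian measure), Hermite coefficients C_σ(h) = ∫_ℝ h(u)(H_σ(u)/√(σ!)) γ₁(du), and Hermite rank m := inf{σ ≥ 1 : C_σ(h) ≠ 0}. Assume R(x) ∼ L(|x|)/|x|^κ as |x| → ∞, with 0 < κ < n/m and L : (0,∞) → (0,∞) slowly varying at infinity and bounded on each finite interval. For each s > 0 let G_s : ℝⁿ → ℝ be integrable with ∫ e^{i⟨y,λ⟩} G_s(y) dy = exp(−μ s |λ|^α(1+|λ|²)^{γ/2}). Define s^ε(t,x) := (ε^{mκ/α} L^m(ε^{−1/α}))^{−1/2}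 ( ∫_{ℝⁿ} G_{t/ε}(y) h(ζ(x ε^{−1/α} − y)) dy − C₀(h) ). Then for all t, t' > 0 and x, x' ∈ ℝⁿ: lim_{ε→0⁺} Cov(s^ε(t,x), s^ε(t',x')) = C_m(h)²·K(n,mκ)·∫_{ℝⁿ} e^{i⟨x−x',λ⟩} e^{−μ(t+t')|λ|^{α}} |λ|^{mκ−n} dλ, where K(n,a) := Γ((n−a)/2)/(2^a π^{n/2} Γ(a/2)). -/

import Mathlib

open MeasureTheory ProbabilityTheory Filter Topology
open scoped RealInnerProductSpace

/-- The probabilists' Hermite polynomial of degree `σ`, as a real function. -/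
noncomputable def hermiteFun (σ : ℕ) (u : ℝ) : ℝ :=
  Polynomial.aeval u (Polynomial.hermite σ)

/-- The Tauberian constant `K(n,c) = Γ((n−c)/2)/(2^c π^{n/2} Γ(c/2))`. -/
noncomputable def tauberK (n : ℕ) (c : ℝ) : ℝ :=
  Real.Gamma (((n : ℝ) - c) / 2) /
    ((2 : ℝ) ^ c * Real.pi ^ ((n : ℝ) / 2) * Real.Gamma (c / 2))

/-- `L` is slowly varying at infinity: `L(cy)/L(y) → 1` as `y → ∞`, uniformly
for `c` in compact subintervals of `(0,∞)`. -/
def SlowlyVaryingAtTop (L : ℝ → ℝ) : Prop :=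
  ∀ a b : ℝ, 0 < a → a < b →
    TendstoUniformlyOn (fun y c => L (c * y) / L y) (fun _ => 1) atTop (Set.Icc a b)

section GaussianPolynomials

open Polynomial

lemma integrable_polynomial_gaussianReal (p : ℝ[X]) :
    Integrable (fun x => p.eval x) (gaussianReal 0 1) := by
  induction p using Polynomial.induction_on' with
  | add p q hp hq =>
    simp only [eval_add]
    exact hp.add hq
  | monomial k a =>
    simp only [eval_monomial]
    refine Integrable.const_mul ?_ a
    rcases Nat.eq_zero_or_pos k with rfl | hk
    · simp
    have h := (memLp_id_gaussianReal (μ := 0) (v := 1) (k : NNReal))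
    have h2 := MemLp.integrable_norm_pow (p := k) (by simpa using h) hk.ne'
    refine h2.mono' (by fun_prop) (ae_of_all _ fun x => ?_)
    simp

lemma memLp_two_polynomial_gaussianReal (p : ℝ[X]) :
    MemLp (fun x => p.eval x) 2 (gaussianReal 0 1) := by
  rw [memLp_two_iff_integrable_sq (by fun_prop)]
  exact (integrable_polynomial_gaussianReal (p ^ 2)).congr (ae_of_all _ fun x => eval_pow 2)

/-- Gaussian integration by parts for polynomials. -/
lemma integral_mul_polynomial_gaussianReal (p : ℝ[X]) :
    ∫ x, x * p.eval x ∂(gaussianReal 0 1) = ∫ x, (derivative p).eval x ∂(gaussianReal 0 1) := by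
  have key : ∀ q : ℝ[X], Integrable (fun x => q.eval x * gaussianPDFReal 0 1 x) := by
    intro q
    have := integrable_polynomial_gaussianReal q
    rw [gaussianReal_of_var_ne_zero _ one_ne_zero,
      integrable_withDensity_iff_integrable_smul' (measurable_gaussianPDF _ _)
        (ae_of_all _ fun _ => gaussianPDF_lt_top)] at this
    refine this.congr (ae_of_all _ fun x => ?_)
    simp [toReal_gaussianPDF, mul_comm]
  have hd : ∀ x, HasDerivAt (gaussianPDFReal 0 1) (-x * gaussianPDFReal 0 1 x) x := by
    intro x
    rw [gaussianPDFReal_def]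
    have h1 : HasDerivAt (fun x : ℝ => -(x - 0) ^ 2 / (2 * ((1 : NNReal) : ℝ))) (-x) x := by
      refine ((((hasDerivAt_id x).sub_const 0).pow 2).neg.div_const
        (2 * ((1 : NNReal) : ℝ))).congr_deriv ?_
      simp only [id, sub_zero, Nat.cast_ofNat, NNReal.coe_one]
      ring
    refine (h1.exp.const_mul (√(2 * Real.pi * ((1 : NNReal) : ℝ)))⁻¹).congr_deriv ?_
    ring
  have hx := integral_mul_deriv_eq_deriv_mul_of_integrable
    (u := fun x => p.eval x) (v := gaussianPDFReal 0 1)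
    (u' := fun x => (derivative p).eval x) (v' := fun x => -x * gaussianPDFReal 0 1 x)
    (fun x _ => p.hasDerivAt x) (fun x _ => hd x)
    ((key (-X * p)).congr (ae_of_all _ fun x => by simp; ring)) (key _) (key _)
  rw [integral_gaussianReal_eq_integral_smul one_ne_zero,
    integral_gaussianReal_eq_integral_smul one_ne_zero]
  simp only [smul_eq_mul]
  calc ∫ x, gaussianPDFReal 0 1 x * (x * p.eval x)
      = -∫ x, p.eval x * (-x * gaussianPDFReal 0 1 x) := by
        rw [← integral_neg]
        exact integral_congr_ae (ae_of_all _ fun x => by ring)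
    _ = ∫ x, (derivative p).eval x * gaussianPDFReal 0 1 x := by rw [hx, neg_neg]
    _ = _ := integral_congr_ae (ae_of_all _ fun x => by ring)

/-- The pair `(x, ρ x + √(1 - ρ²) z)` for independent standard Gaussians `x`, `z`. -/
noncomputable def correlatedPair (ρ : ℝ) : ℝ × ℝ →L[ℝ] ℝ × ℝ :=
  (ContinuousLinearMap.fst ℝ ℝ ℝ).prod
    (ρ • ContinuousLinearMap.fst ℝ ℝ ℝ + √(1 - ρ ^ 2) • ContinuousLinearMap.snd ℝ ℝ ℝ)

lemma correlatedPair_apply (ρ : ℝ) (w : ℝ × ℝ) :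
    correlatedPair ρ w = (w.1, ρ * w.1 + √(1 - ρ ^ 2) * w.2) := rfl

variable {Ω : Type*} [MeasurableSpace Ω] {P : Measure Ω} {X Y : Ω → ℝ}

lemma gaussian_moments {Z : Ω → ℝ} {v : NNReal} (hZm : AEMeasurable Z P)
    (hZ : P.map Z = gaussianReal 0 v) :
    MemLp Z 2 P ∧ ∫ ω, Z ω ^ 2 ∂P = v := by
  have h2 : MemLp id 2 (gaussianReal 0 v) := memLp_id_gaussianReal 2
  constructor
  · rw [← hZ, memLp_map_measure_iff (by fun_prop) hZm] at h2
    exact h2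
  · have hv := variance_fun_id_gaussianReal (μ := 0) (v := v)
    rw [variance_eq_integral (by fun_prop)] at hv
    simp only [integral_id_gaussianReal, sub_zero] at hv
    rw [← hv, ← hZ, integral_map hZm (by fun_prop)]

lemma map_pair_eq_map_correlatedPair [IsProbabilityMeasure P] (hX : Measurable X)
    (hY : Measurable Y)
    (hG : ∀ a b : ℝ, ∃ v : NNReal, P.map (fun ω => a * X ω + b * Y ω) = gaussianReal 0 v)
    (hX2 : ∫ ω, X ω ^ 2 ∂P = 1) (hY2 : ∫ ω, Y ω ^ 2 ∂P = 1) {ρ : ℝ}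
    (hXY : ∫ ω, X ω * Y ω ∂P = ρ) :
    P.map (fun ω => (X ω, Y ω)) =
      ((gaussianReal 0 1).prod (gaussianReal 0 1)).map (correlatedPair ρ) := by
  have hXL : MemLp X 2 P := by
    obtain ⟨v, hv⟩ := hG 1 0
    exact (gaussian_moments hX.aemeasurable (by simpa using hv)).1
  have hYL : MemLp Y 2 P := by
    obtain ⟨v, hv⟩ := hG 0 1
    exact (gaussian_moments hY.aemeasurable (by simpa using hv)).1
  have hvar : ∀ a b : ℝ, ∀ v : NNReal, P.map (fun ω => a * X ω + b * Y ω) = gaussianReal 0 v →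
      (v : ℝ) = a ^ 2 + 2 * a * b * ρ + b ^ 2 := by
    intro a b v hv
    rw [← (gaussian_moments (by fun_prop) hv).2]
    have e : ∀ ω, (a * X ω + b * Y ω) ^ 2 =
        a ^ 2 * X ω ^ 2 + 2 * a * b * (X ω * Y ω) + b ^ 2 * Y ω ^ 2 := fun ω => by ring
    simp_rw [e]
    have i1 := hXL.integrable_sq.const_mul (a ^ 2)
    have i2 : Integrable (fun ω => 2 * a * b * (X ω * Y ω)) P :=
      (hXL.integrable_mul hYL).const_mul (2 * a * b)
    have i3 := hYL.integrable_sq.const_mul (b ^ 2)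
    rw [integral_add (i1.fun_add i2) i3, integral_add i1 i2, integral_const_mul, integral_const_mul,
      integral_const_mul, hX2, hY2, hXY]
    ring
  have hρ : ρ ^ 2 ≤ 1 := by
    obtain ⟨v, hv⟩ := hG (-ρ) 1
    have := hvar _ _ v hv
    nlinarith [v.2, v.coe_nonneg]
  have hXYm : Measurable fun ω => (X ω, Y ω) := hX.prodMk hY
  have := Measure.isProbabilityMeasure_map (μ := P) hXYm.aemeasurable
  have := Measure.isProbabilityMeasure_map
    (μ := (gaussianReal 0 1).prod (gaussianReal 0 1)) (correlatedPair ρ).continuous.aemeasurable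
  refine Measure.ext_of_charFunDual ?_
  ext M
  set a := M (1, 0) with ha
  set b := M (0, 1) with hb
  have hM : ∀ x y : ℝ, M (x, y) = a * x + b * y := by
    intro x y
    have : (x, y) = x • ((1 : ℝ), (0 : ℝ)) + y • ((0 : ℝ), (1 : ℝ)) := by simp
    rw [this, map_add, map_smul, map_smul, ← ha, ← hb]
    simp [mul_comm]
  obtain ⟨v, hv⟩ := hG a b
  have l1 : charFunDual (P.map fun ω => (X ω, Y ω)) M
      = charFun (P.map (fun ω => a * X ω + b * Y ω)) 1 := by
    rw [charFunDual_apply, charFun_apply_real, integral_map hXYm.aemeasurable (by fun_prop),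
      integral_map (by fun_prop) (by fun_prop)]
    simp [hM]
  have l2 : charFunDual (((gaussianReal 0 1).prod (gaussianReal 0 1)).map (correlatedPair ρ)) M
      = charFun (gaussianReal 0 1) (a + b * ρ) *
        charFun (gaussianReal 0 1) (b * √(1 - ρ ^ 2)) := by
    rw [charFunDual_apply, charFun_apply_real, charFun_apply_real,
      integral_map (by fun_prop) (by fun_prop), ← integral_prod_mul]
    congr 1 with w
    rw [← Complex.exp_add, correlatedPair_apply, hM]
    push_cast
    ring_nf
  rw [l1, l2, hv, charFun_gaussianReal, charFun_gaussianReal, charFun_gaussianReal,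
    ← Complex.exp_add]
  congr 1
  have hs : ((√(1 - ρ ^ 2) : ℝ) : ℂ) ^ 2 = 1 - (ρ : ℂ) ^ 2 := by
    rw [← Complex.ofReal_pow, Real.sq_sqrt (by linarith)]
    push_cast; ring
  have hvc : ((v : ℝ) : ℂ) = a ^ 2 + 2 * a * b * ρ + b ^ 2 := by
    rw [hvar a b v hv]; push_cast; ring
  push_cast
  rw [mul_pow, hs, hvc]
  ring

/-- The bivariate Gaussian law with standard marginals and correlation `ρ`. -/
structure IsStdGaussianPair (P : Measure Ω) (X Y : Ω → ℝ) (ρ : ℝ) : Prop where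
  left : MeasurePreserving X P (gaussianReal 0 1)
  right : MeasurePreserving Y P (gaussianReal 0 1)
  law : P.map (fun ω => (X ω, Y ω)) =
      ((gaussianReal 0 1).prod (gaussianReal 0 1)).map (correlatedPair ρ)

lemma isStdGaussianPair_of_linear_combinations [IsProbabilityMeasure P] (hX : Measurable X)
    (hY : Measurable Y)
    (hG : ∀ a b : ℝ, ∃ v : NNReal, P.map (fun ω => a * X ω + b * Y ω) = gaussianReal 0 v)
    (hX2 : ∫ ω, X ω ^ 2 ∂P = 1) (hY2 : ∫ ω, Y ω ^ 2 ∂P = 1) {ρ : ℝ}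
    (hXY : ∫ ω, X ω * Y ω ∂P = ρ) : IsStdGaussianPair P X Y ρ := by
  refine ⟨⟨hX, ?_⟩, ⟨hY, ?_⟩, map_pair_eq_map_correlatedPair hX hY hG hX2 hY2 hXY⟩
  · obtain ⟨v, hv⟩ := hG 1 0
    simp only [one_mul, zero_mul, add_zero] at hv
    have := (gaussian_moments hX.aemeasurable hv).2
    rw [hX2] at this
    rw [show (fun ω => X ω) = X from rfl] at hv
    rw [hv, show v = 1 from by ext; simp [← this]]
  · obtain ⟨v, hv⟩ := hG 0 1
    simp only [one_mul, zero_mul, zero_add] at hv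
    have := (gaussian_moments hY.aemeasurable hv).2
    rw [hY2] at this
    rw [show (fun ω => Y ω) = Y from rfl] at hv
    rw [hv, show v = 1 from by ext; simp [← this]]

lemma IsStdGaussianPair.integrable_mul {ρ : ℝ} (hP : IsStdGaussianPair P X Y ρ)
    {g h : ℝ → ℝ} (hg : MemLp g 2 (gaussianReal 0 1)) (hh : MemLp h 2 (gaussianReal 0 1)) :
    Integrable (fun ω => g (X ω) * h (Y ω)) P :=
  (hg.comp_measurePreserving hP.left).integrable_mul (hh.comp_measurePreserving hP.right)

lemma IsStdGaussianPair.integral_polynomial {ρ : ℝ} (hP : IsStdGaussianPair P X Y ρ)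
    (p q : ℝ[X]) :
    Integrable (fun w : ℝ × ℝ => p.eval w.1 * q.eval (ρ * w.1 + √(1 - ρ ^ 2) * w.2))
      ((gaussianReal 0 1).prod (gaussianReal 0 1)) ∧
    ∫ ω, p.eval (X ω) * q.eval (Y ω) ∂P =
      ∫ z, ∫ x, p.eval x * q.eval (ρ * x + √(1 - ρ ^ 2) * z) ∂(gaussianReal 0 1)
        ∂(gaussianReal 0 1) := by
  have hm : Measurable fun ω => (X ω, Y ω) := hP.left.measurable.prodMk hP.right.measurable
  have h1 : Integrable (fun w : ℝ × ℝ => p.eval w.1 * q.eval w.2)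
      (P.map (fun ω => (X ω, Y ω))) := by
    rw [integrable_map_measure (by fun_prop) hm.aemeasurable]
    exact hP.integrable_mul (memLp_two_polynomial_gaussianReal p)
      (memLp_two_polynomial_gaussianReal q)
  have h2 := h1
  rw [hP.law, integrable_map_measure (by fun_prop) (by fun_prop)] at h2
  refine ⟨h2, ?_⟩
  have e1 := integral_map (μ := P) hm.aemeasurable h1.aestronglyMeasurable
  rw [hP.law, integral_map (by fun_prop) (by fun_prop)] at e1
  rw [← e1]
  exact integral_prod_symm _ h2

lemma IsStdGaussianPair.integral_mul_left {ρ : ℝ} (hP : IsStdGaussianPair P X Y ρ)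
    (p q : ℝ[X]) :
    ∫ ω, (X ω * p.eval (X ω)) * q.eval (Y ω) ∂P =
      ∫ ω, (derivative p).eval (X ω) * q.eval (Y ω) ∂P +
        ρ * ∫ ω, p.eval (X ω) * (derivative q).eval (Y ω) ∂P := by
  have h0 := hP.integral_polynomial (Polynomial.X * p) q
  have h1 := hP.integral_polynomial (derivative p) q
  have h2 := hP.integral_polynomial p (derivative q)
  simp only [eval_mul, eval_X] at h0
  rw [h0.2, h1.2, h2.2, ← integral_const_mul, ← integral_add h1.1.integral_prod_right
    (h2.1.integral_prod_right.const_mul ρ)]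
  congr 1 with z
  set s := √(1 - ρ ^ 2)
  have key := integral_mul_polynomial_gaussianReal
    (p * q.comp (Polynomial.C ρ * Polynomial.X + Polynomial.C (s * z)))
  have i1 := integrable_polynomial_gaussianReal
    (derivative p * q.comp (Polynomial.C ρ * Polynomial.X + Polynomial.C (s * z)))
  have i2 := integrable_polynomial_gaussianReal
    (p * (derivative q).comp (Polynomial.C ρ * Polynomial.X + Polynomial.C (s * z)))
  simp only [eval_mul, eval_comp, eval_add, eval_C, eval_X, derivative_mul, derivative_comp,
    derivative_add, derivative_C, derivative_X] at key i1 i2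
  rw [← integral_const_mul, ← integral_add i1 (i2.const_mul ρ)]
  simp_rw [mul_assoc]
  rw [key]
  congr 1 with x
  simp
  ring

end GaussianPolynomials

section HermiteExpansion

open Polynomial

/-- The real Hermite polynomial. -/
noncomputable def realHermite (k : ℕ) : ℝ[X] := (hermite k).map (Int.castRingHom ℝ)

lemma eval_realHermite (k : ℕ) (x : ℝ) : (realHermite k).eval x = hermiteFun k x := by
  rw [realHermite, eval_map, hermiteFun, aeval_def]
  rfl

lemma realHermite_succ (k : ℕ) :
    realHermite (k + 1) = Polynomial.X * realHermite k - derivative (realHermite k) := by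
  simp [realHermite, hermite_succ, derivative_map]

lemma realHermite_monic (k : ℕ) : (realHermite k).Monic := (hermite_monic k).map _

lemma degree_realHermite (k : ℕ) : (realHermite k).degree = k := by
  rw [realHermite, (hermite_monic k).degree_map, degree_hermite]

/-- Hermite polynomials as a graded sequence of polynomials. -/
noncomputable def realHermiteSequence : Polynomial.Sequence ℝ where
  elems' := realHermite
  degree_eq' k := degree_realHermite k

lemma span_realHermite : Submodule.span ℝ (Set.range realHermite) = ⊤ :=
  realHermiteSequence.span fun i => by
    have : (realHermiteSequence i).leadingCoeff = 1 := realHermite_monic i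
    rw [this]; exact isUnit_one

variable {Ω : Type*} [MeasurableSpace Ω] {P : Measure Ω} {X Y : Ω → ℝ} {ρ : ℝ}

lemma IsStdGaussianPair.integral_realHermite_mul (hP : IsStdGaussianPair P X Y ρ) (j : ℕ)
    (q : ℝ[X]) :
    ∫ ω, (realHermite j).eval (X ω) * q.eval (Y ω) ∂P =
      ρ ^ j * ∫ x, (derivative^[j] q).eval x ∂(gaussianReal 0 1) := by
  induction j generalizing q with
  | zero =>
    simp only [realHermite, hermite_zero, Polynomial.map_C, eval_C, Function.iterate_zero, id]
    rw [← hP.right.map_eq, integral_map hP.right.measurable.aemeasurable (by fun_prop)]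
    simp
  | succ j ih =>
    have hI := fun p q : ℝ[X] => hP.integrable_mul (memLp_two_polynomial_gaussianReal p)
      (memLp_two_polynomial_gaussianReal q)
    have h1 := hI (Polynomial.X * realHermite j) q
    simp only [eval_mul, eval_X] at h1
    simp only [realHermite_succ, eval_sub, eval_mul, eval_X, sub_mul]
    rw [integral_sub h1 (hI _ _), hP.integral_mul_left, add_sub_cancel_left, ih, pow_succ,
      Function.iterate_succ_apply]
    ring

lemma iterate_derivative_realHermite_self (k : ℕ) :
    derivative^[k] (realHermite k) = Polynomial.C (k.factorial : ℝ) := by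
  have hdeg : (realHermite k).natDegree = k :=
    natDegree_eq_of_degree_eq_some (degree_realHermite k)
  have h0 : (derivative^[k] (realHermite k)).natDegree = 0 := by
    have := natDegree_iterate_derivative (realHermite k) k
    omega
  rw [eq_C_of_natDegree_eq_zero h0, coeff_iterate_derivative, zero_add,
    Nat.descFactorial_self]
  have : (realHermite k).coeff k = 1 := by
    have := realHermite_monic k
    rwa [Monic, leadingCoeff, hdeg] at this
  simp [this]

lemma IsStdGaussianPair.integral_realHermite (hP : IsStdGaussianPair P X Y ρ)
    (hP' : IsStdGaussianPair P Y X ρ) (j k : ℕ) :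
    ∫ ω, (realHermite j).eval (X ω) * (realHermite k).eval (Y ω) ∂P =
      if j = k then ρ ^ j * j.factorial else 0 := by
  have hdeg : ∀ k, (realHermite k).natDegree = k := fun k =>
    natDegree_eq_of_degree_eq_some (degree_realHermite k)
  rcases lt_trichotomy j k with h | h | h
  · simp_rw [if_neg h.ne, mul_comm ((realHermite j).eval _)]
    rw [hP'.integral_realHermite_mul,
      iterate_derivative_eq_zero (by rw [hdeg]; exact h)]
    simp
  · subst h
    rw [hP.integral_realHermite_mul, iterate_derivative_realHermite_self]
    simp
  · rw [hP.integral_realHermite_mul, if_neg h.ne',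
      iterate_derivative_eq_zero (by rw [hdeg]; exact h)]
    simp

/-- The normalized Hermite polynomial. -/
noncomputable def hermiteNormalized (k : ℕ) (x : ℝ) : ℝ := hermiteFun k x / √(k.factorial)

lemma memLp_hermiteNormalized (k : ℕ) : MemLp (hermiteNormalized k) 2 (gaussianReal 0 1) := by
  have := (memLp_two_polynomial_gaussianReal (realHermite k)).mul_const (√(k.factorial))⁻¹
  simp only [eval_realHermite, ← div_eq_mul_inv] at this
  exact this

lemma IsStdGaussianPair.integral_hermiteNormalized (hP : IsStdGaussianPair P X Y ρ)
    (hP' : IsStdGaussianPair P Y X ρ) (j k : ℕ) :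
    ∫ ω, hermiteNormalized j (X ω) * hermiteNormalized k (Y ω) ∂P =
      if j = k then ρ ^ j else 0 := by
  have e : ∀ ω, hermiteNormalized j (X ω) * hermiteNormalized k (Y ω) =
      (√(j.factorial))⁻¹ * (√(k.factorial))⁻¹ *
        ((realHermite j).eval (X ω) * (realHermite k).eval (Y ω)) := fun ω => by
    simp only [eval_realHermite, hermiteNormalized]; ring
  simp_rw [e]
  rw [integral_const_mul, hP.integral_realHermite hP']
  split_ifs with h
  · subst h
    have : (0 : ℝ) < j.factorial := by exact_mod_cast j.factorial_pos
    rw [← mul_inv, Real.mul_self_sqrt this.le]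
    field_simp
  · simp

lemma isStdGaussianPair_id :
    IsStdGaussianPair (gaussianReal 0 1) (fun x => x) (fun x => x) 1 := by
  refine ⟨MeasurePreserving.id _, MeasurePreserving.id _, ?_⟩
  have : (correlatedPair 1 : ℝ × ℝ → ℝ × ℝ) = (fun x : ℝ => (x, x)) ∘ Prod.fst := by
    ext w <;> simp [correlatedPair_apply]
  rw [this, ← Measure.map_map (by fun_prop) (by fun_prop), Measure.map_fst_prod]
  simp

/-- Polynomials are complete in the space of square integrable functions for the standard
Gaussian measure. -/
lemma ae_eq_zero_of_integral_pow_eq_zero {h : ℝ → ℝ} (hm : Measurable h)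
    (hh : MemLp h 2 (gaussianReal 0 1))
    (h0 : ∀ k : ℕ, ∫ x, x ^ k * h x ∂(gaussianReal 0 1) = 0) :
    h =ᵐ[gaussianReal 0 1] 0 := by
  have hexp : ∀ t : ℝ, Integrable (fun x => Real.exp (|t| * |x|) * |h x|) (gaussianReal 0 1) := by
    intro t
    have h1 : MemLp (fun x : ℝ => Real.exp (|t| * |x|)) 2 (gaussianReal 0 1) := by
      rw [memLp_two_iff_integrable_sq (by fun_prop)]
      refine ((integrable_exp_mul_gaussianReal (2 * |t|)).add
        (integrable_exp_mul_gaussianReal (-(2 * |t|)))).mono' (by fun_prop)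
        (ae_of_all _ fun x => ?_)
      rw [Real.norm_of_nonneg (by positivity), ← Real.exp_nat_mul, Pi.add_apply]
      rcases abs_cases x with ⟨h, _⟩ | ⟨h, _⟩
      · rw [h]
        refine le_trans (le_of_eq ?_) (le_add_of_nonneg_right (Real.exp_pos _).le)
        push_cast; ring_nf
      · rw [h]
        refine le_trans (le_of_eq ?_) (le_add_of_nonneg_left (Real.exp_pos _).le)
        push_cast; ring_nf
    exact h1.integrable_mul hh.abs
  have hfi : Integrable h (gaussianReal 0 1) := hh.integrable (by norm_num)
  have hchar : ∀ t : ℝ,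
      ∫ x, Complex.exp (t * x * Complex.I) * (h x : ℂ) ∂(gaussianReal 0 1) = 0 := by
    intro t
    have hs := hasSum_integral_of_dominated_convergence (μ := gaussianReal 0 1)
      (F := fun (k : ℕ) (x : ℝ) => ((t * x * Complex.I) ^ k / (k.factorial : ℂ)) * (h x : ℂ))
      (f := fun x => Complex.exp (t * x * Complex.I) * (h x : ℂ))
      (fun (k : ℕ) (x : ℝ) => ((|t| * |x|) ^ k / (k.factorial : ℝ)) * |h x|)
      (fun k => by fun_prop) (fun k => ae_of_all _ fun x => by simp)
      (ae_of_all _ fun x => (Real.summable_pow_div_factorial _).mul_right _)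
      (by
        refine (hexp t).congr (ae_of_all _ fun x => ?_)
        simp only
        rw [tsum_mul_right, Real.exp_eq_exp_ℝ, NormedSpace.exp_eq_tsum_div])
      (ae_of_all _ fun x => by
        have := NormedSpace.expSeries_div_hasSum_exp (𝔸 := ℂ) (t * x * Complex.I)
        rw [← Complex.exp_eq_exp_ℂ] at this
        exact this.mul_right _)
    have hz : ∀ k : ℕ, ∫ x : ℝ, ((t * x * Complex.I) ^ k / (k.factorial : ℂ)) * (h x : ℂ)
        ∂(gaussianReal 0 1) = 0 := by
      intro k
      have e : ∀ x : ℝ, ((t * x * Complex.I) ^ k / (k.factorial : ℂ)) * (h x : ℂ) =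
          ((t * Complex.I) ^ k / (k.factorial : ℂ)) * ((x ^ k * h x : ℝ) : ℂ) := fun x => by
        push_cast; ring
      simp_rw [e]
      rw [integral_const_mul, integral_complex_ofReal, h0]
      simp
    simp_rw [hz] at hs
    exact hs.unique hasSum_zero
  set μ₁ := (gaussianReal 0 1).withDensity fun x => ENNReal.ofReal (h x)
  set μ₂ := (gaussianReal 0 1).withDensity fun x => ENNReal.ofReal (-h x)
  have f1 : IsFiniteMeasure μ₁ := isFiniteMeasure_withDensity_ofReal hfi.2
  have f2 : IsFiniteMeasure μ₂ := isFiniteMeasure_withDensity_ofReal hfi.neg.2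
  have hμ : μ₁ = μ₂ := by
    refine Measure.ext_of_charFun ?_
    ext t
    rw [charFun_apply_real, charFun_apply_real,
      integral_withDensity_eq_integral_toReal_smul (by fun_prop)
        (ae_of_all _ fun _ => ENNReal.ofReal_lt_top),
      integral_withDensity_eq_integral_toReal_smul (by fun_prop)
        (ae_of_all _ fun _ => ENNReal.ofReal_lt_top), ← sub_eq_zero, ← integral_sub]
    · rw [← hchar t]
      refine integral_congr_ae (ae_of_all _ fun x => ?_)
      simp only
      rw [← sub_smul, ENNReal.toReal_ofReal', ENNReal.toReal_ofReal', max_zero_sub_eq_self,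
        Complex.real_smul, mul_comm]
    all_goals
      refine hfi.abs.mono' (by fun_prop) (ae_of_all _ fun x => ?_)
      rw [norm_smul, ← Complex.ofReal_mul, Complex.norm_exp_ofReal_mul_I, mul_one,
        Real.norm_of_nonneg (by positivity), ENNReal.toReal_ofReal']
      rcases abs_cases (h x) with ⟨h, _⟩ | ⟨h, _⟩ <;> rw [h] <;> simp <;> linarith
  rw [withDensity_eq_iff (by fun_prop) (by fun_prop)
    (by have := f1.1; rw [withDensity_apply _ MeasurableSet.univ, setLIntegral_univ] at this
        exact this.ne)] at hμ
  filter_upwards [hμ] with x hx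
  rcases le_total (h x) 0 with h1 | h1
  · rw [ENNReal.ofReal_of_nonpos h1, eq_comm, ENNReal.ofReal_eq_zero] at hx
    simp only [Pi.zero_apply]; linarith
  · rw [ENNReal.ofReal_of_nonpos (p := -h x) (by linarith), ENNReal.ofReal_eq_zero] at hx
    simp only [Pi.zero_apply]; linarith

/-- The normalized Hermite polynomials as elements of `L²` of the standard Gaussian measure. -/
noncomputable def hermiteLp (k : ℕ) : Lp ℝ 2 (gaussianReal 0 1) :=
  (memLp_hermiteNormalized k).toLp

lemma inner_toLp_toLp {α : Type*} [MeasurableSpace α] {ν : Measure α} {f g : α → ℝ}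
    (hf : MemLp f 2 ν) (hg : MemLp g 2 ν) :
    ⟪hf.toLp, hg.toLp⟫ = ∫ x, f x * g x ∂ν := by
  rw [L2.inner_def]
  refine integral_congr_ae ?_
  filter_upwards [hf.coeFn_toLp, hg.coeFn_toLp] with x h1 h2
  rw [h1, h2, real_inner_eq_re_inner ℝ]
  simp [mul_comm]

lemma orthonormal_hermiteLp : Orthonormal ℝ hermiteLp := by
  rw [orthonormal_iff_ite]
  intro i j
  rw [hermiteLp, hermiteLp, inner_toLp_toLp,
    isStdGaussianPair_id.integral_hermiteNormalized isStdGaussianPair_id]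
  simp

lemma orthogonal_span_hermiteLp : (Submodule.span ℝ (Set.range hermiteLp))ᗮ = ⊥ := by
  rw [Submodule.eq_bot_iff]
  intro v hv
  rw [Submodule.mem_orthogonal] at hv
  have hvL : MemLp v 2 (gaussianReal 0 1) := Lp.memLp v
  have hsm := Lp.stronglyMeasurable v
  have hI : ∀ p : ℝ[X], Integrable (fun x => p.eval x * v x) (gaussianReal 0 1) := fun p =>
    (memLp_two_polynomial_gaussianReal p).integrable_mul hvL
  have h1 : ∀ k, ∫ x, (realHermite k).eval x * v x ∂(gaussianReal 0 1) = 0 := by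
    intro k
    have h2 := hv (hermiteLp k) (Submodule.subset_span ⟨k, rfl⟩)
    have h3 : v = hvL.toLp := (Lp.toLp_coeFn v hvL).symm
    rw [h3, hermiteLp, inner_toLp_toLp] at h2
    have e : ∀ x, hermiteNormalized k x * v x =
        (√(k.factorial))⁻¹ * ((realHermite k).eval x * v x) := fun x => by
      rw [hermiteNormalized, eval_realHermite]; ring
    simp_rw [e] at h2
    rw [integral_const_mul] at h2
    have : (√(k.factorial : ℝ))⁻¹ ≠ 0 := by positivity
    exact (mul_eq_zero.1 h2).resolve_left this
  have h2 : ∀ p : ℝ[X], ∫ x, p.eval x * v x ∂(gaussianReal 0 1) = 0 := by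
    intro p
    have hp : p ∈ Submodule.span ℝ (Set.range realHermite) := by
      rw [span_realHermite]; trivial
    induction hp using Submodule.span_induction with
    | mem q hq => obtain ⟨k, rfl⟩ := hq; exact h1 k
    | zero => simp
    | add q r _ _ hq hr =>
      simp only [eval_add, add_mul]
      rw [integral_add (hI q) (hI r), hq, hr, add_zero]
    | smul c q _ hq =>
      simp only [eval_smul, smul_eq_mul, mul_assoc]
      rw [integral_const_mul, hq, mul_zero]
  have h3 := ae_eq_zero_of_integral_pow_eq_zero hsm.measurable hvL fun k => by
    simpa using h2 (Polynomial.X ^ k)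
  exact Lp.ext (h3.trans (Lp.coeFn_zero _ _ _).symm)

/-- The covariance of a square integrable function of a standard Gaussian pair expands in powers
of the correlation, with the squared Hermite coefficients as weights. -/
theorem IsStdGaussianPair.hasSum_integral_mul (hP : IsStdGaussianPair P X Y ρ)
    (hP' : IsStdGaussianPair P Y X ρ) {h : ℝ → ℝ} (hh : MemLp h 2 (gaussianReal 0 1)) :
    HasSum (fun k => (∫ u, h u * hermiteNormalized k u ∂(gaussianReal 0 1)) ^ 2 * ρ ^ k)
      (∫ ω, h (X ω) * h (Y ω) ∂P) := by
  set c : ℕ → ℝ := fun k => ∫ u, h u * hermiteNormalized k u ∂(gaussianReal 0 1) with hc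
  set b := HilbertBasis.mkOfOrthogonalEqBot orthonormal_hermiteLp orthogonal_span_hermiteLp with hb
  have hbe : ∀ k, b k = hermiteLp k := fun k => by
    rw [hb, HilbertBasis.coe_mkOfOrthogonalEqBot]
  have hrep : HasSum (fun k => c k • hermiteLp k) hh.toLp := by
    have := b.hasSum_repr hh.toLp
    have e : ∀ k, b.repr hh.toLp k • b k = c k • hermiteLp k := fun k => by
      rw [b.repr_apply_apply, hbe, hermiteLp, inner_toLp_toLp, hc]
      simp_rw [mul_comm]
    simpa only [e] using this
  set UX := Lp.compMeasurePreservingₗᵢ ℝ (E := ℝ) (p := 2) X hP.left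
  set UY := Lp.compMeasurePreservingₗᵢ ℝ (E := ℝ) (p := 2) Y hP.right
  have hUX : ∀ {g : ℝ → ℝ} (hg : MemLp g 2 (gaussianReal 0 1)),
      UX hg.toLp = (hg.comp_measurePreserving hP.left).toLp := fun hg =>
    Lp.toLp_compMeasurePreserving hg hP.left
  have hUY : ∀ {g : ℝ → ℝ} (hg : MemLp g 2 (gaussianReal 0 1)),
      UY hg.toLp = (hg.comp_measurePreserving hP.right).toLp := fun hg =>
    Lp.toLp_compMeasurePreserving hg hP.right
  have hee : ∀ j k, ⟪UX (hermiteLp j), UY (hermiteLp k)⟫ = if j = k then ρ ^ j else 0 := by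
    intro j k
    rw [hermiteLp, hermiteLp, hUX, hUY, inner_toLp_toLp]
    exact hP.integral_hermiteNormalized hP' j k
  have h1 : ∀ j, ⟪UX (hermiteLp j), UY hh.toLp⟫ = c j * ρ ^ j := by
    intro j
    have := (hrep.mapL (UY.toContinuousLinearMap)).mapL (innerSL ℝ (UX (hermiteLp j)))
    refine this.unique ?_
    have e : ∀ k, innerSL ℝ (UX (hermiteLp j))
        (UY.toContinuousLinearMap (c k • hermiteLp k)) = if k = j then c j * ρ ^ j else 0 := by
      intro k
      rw [map_smul, map_smul, innerSL_apply_apply, LinearIsometry.coe_toContinuousLinearMap, hee,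
        smul_eq_mul]
      by_cases hjk : j = k
      · subst hjk; simp
      · simp [hjk, Ne.symm hjk]
    simp only [e]
    exact hasSum_ite_eq j (c j * ρ ^ j)
  have h2 := (hrep.mapL (UX.toContinuousLinearMap)).mapL (innerSL ℝ (UY hh.toLp))
  have h3 : innerSL ℝ (UY hh.toLp) (UX.toContinuousLinearMap hh.toLp) =
      ∫ ω, h (X ω) * h (Y ω) ∂P := by
    rw [innerSL_apply_apply, LinearIsometry.coe_toContinuousLinearMap, real_inner_comm, hUX, hUY,
      inner_toLp_toLp]
    rfl
  have e : ∀ k, innerSL ℝ (UY hh.toLp) (UX.toContinuousLinearMap (c k • hermiteLp k)) =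
      c k ^ 2 * ρ ^ k := fun k => by
    rw [map_smul, map_smul, innerSL_apply_apply, LinearIsometry.coe_toContinuousLinearMap,
      real_inner_comm, h1, smul_eq_mul]
    ring
  rw [h3] at h2
  simpa only [e] using h2

end HermiteExpansion

lemma norm_cexp_inner_mul_I {E : Type*} [NormedAddCommGroup E] [InnerProductSpace ℝ E] (x z : E) :
    ‖Complex.exp ((⟪x, z⟫ : ℝ) * Complex.I)‖ = 1 :=
  Complex.norm_exp_ofReal_mul_I _

section SpectralMeasure

variable {E : Type*} [NormedAddCommGroup E] [InnerProductSpace ℝ E] [MeasurableSpace E]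
  [BorelSpace E] [SecondCountableTopology E]

/-- Convolution powers of a measure. -/
noncomputable def convPower (ν : Measure E) : ℕ → Measure E
  | 0 => Measure.dirac 0
  | k + 1 => convPower ν k ∗ ν

instance isProbabilityMeasure_convPower (ν : Measure E) [IsProbabilityMeasure ν] (k : ℕ) :
    IsProbabilityMeasure (convPower ν k) := by
  induction k with
  | zero => unfold convPower; infer_instance
  | succ k ih => unfold convPower; infer_instance

lemma charFun_convPower (ν : Measure E) [IsProbabilityMeasure ν] (k : ℕ) (z : E) :
    charFun (convPower ν k) z = charFun ν z ^ k := by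
  induction k with
  | zero => simp [convPower, charFun_apply]
  | succ k ih => rw [convPower, charFun_conv, ih, pow_succ]

/-- A power series with nonnegative summable coefficients in the characteristic function of a
probability measure is the characteristic function of a finite measure. -/
lemma exists_measure_charFun_eq_tsum (ν : Measure E) [IsProbabilityMeasure ν] {c : ℕ → ℝ}
    (hc0 : ∀ k, 0 ≤ c k) (hc : Summable c) :
    ∃ F : Measure E, IsFiniteMeasure F ∧ ∀ z, charFun F z = ∑' k, (c k : ℂ) * charFun ν z ^ k := by
  set F : Measure E := Measure.sum fun k => ENNReal.ofReal (c k) • convPower ν k with hF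
  have hfin : IsFiniteMeasure F := by
    refine ⟨?_⟩
    rw [hF, Measure.sum_apply _ MeasurableSet.univ]
    simp only [Measure.smul_apply, measure_univ, smul_eq_mul, mul_one]
    rw [← ENNReal.ofReal_tsum_of_nonneg hc0 hc]
    exact ENNReal.ofReal_lt_top
  refine ⟨F, hfin, fun z => ?_⟩
  have hfi : Integrable (fun x : E => Complex.exp ((⟪x, z⟫ : ℝ) * Complex.I)) F :=
    (integrable_const (1 : ℝ)).mono' (by fun_prop)
      (ae_of_all _ fun x => (norm_cexp_inner_mul_I x z).le)
  rw [charFun_apply, hF, integral_sum_measure hfi]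
  refine tsum_congr fun k => ?_
  rw [integral_smul_measure, ENNReal.toReal_ofReal (hc0 k), ← charFun_apply, charFun_convPower,
    Complex.real_smul]

/-- The transform of a symmetric double convolution integral against a characteristic function. -/
lemma integral_integral_charFun {F : Measure E} [IsFiniteMeasure F] {V : Measure E} [SFinite V]
    {g g' : E → ℝ} (hg : Integrable g V) (hg' : Integrable g' V) (a : E) :
    ∫ p : E × E, ((g p.1 * g' p.2 : ℝ) : ℂ) * charFun F (a - p.1 + p.2) ∂(V.prod V) =
      ∫ l, Complex.exp ((⟪l, a⟫ : ℝ) * Complex.I) *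
        ((∫ y, Complex.exp (Complex.I * ((⟪y, -l⟫ : ℝ) : ℂ)) * (g y : ℂ) ∂V) *
        (∫ y, Complex.exp (Complex.I * ((⟪y, l⟫ : ℝ) : ℂ)) * (g' y : ℂ) ∂V)) ∂F := by
  have hgg := hg.mul_prod hg'
  have e : ∀ p : E × E, ((g p.1 * g' p.2 : ℝ) : ℂ) * charFun F (a - p.1 + p.2) =
      ∫ l, ((g p.1 * g' p.2 : ℝ) : ℂ) *
        Complex.exp ((⟪l, a - p.1 + p.2⟫ : ℝ) * Complex.I) ∂F := fun p => by
    rw [charFun_apply, integral_const_mul]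
  simp_rw [e]
  rw [integral_integral_swap]
  · refine integral_congr_ae (ae_of_all _ fun l => ?_)
    simp only
    rw [← integral_prod_mul, ← integral_const_mul]
    refine integral_congr_ae (ae_of_all _ fun p => ?_)
    simp only [inner_add_right, inner_sub_right, inner_neg_right, Complex.ofReal_add,
      Complex.ofReal_sub, Complex.ofReal_mul, Complex.ofReal_neg, real_inner_comm l]
    have : Complex.exp ((((⟪l, a⟫ : ℝ) : ℂ) - ((⟪l, p.1⟫ : ℝ) : ℂ) + ((⟪l, p.2⟫ : ℝ) : ℂ)) *
        Complex.I) = Complex.exp (((⟪l, a⟫ : ℝ) : ℂ) * Complex.I) *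
        Complex.exp (Complex.I * -((⟪l, p.1⟫ : ℝ) : ℂ)) *
        Complex.exp (Complex.I * ((⟪l, p.2⟫ : ℝ) : ℂ)) := by
      rw [← Complex.exp_add, ← Complex.exp_add]; ring_nf
    rw [this]; ring
  · have h1 : Integrable (fun q : (E × E) × E => ((g q.1.1 * g' q.1.2 : ℝ) : ℂ) * 1)
        ((V.prod V).prod F) := (hgg.ofReal (𝕜 := ℂ)).mul_prod (integrable_const (1 : ℂ))
    refine h1.norm.mono' ?_ (ae_of_all _ fun q => ?_)
    · have h2 := h1.aestronglyMeasurable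
      simp only [mul_one] at h2
      exact h2.mul (by fun_prop)
    · simp only [Function.uncurry, norm_mul, norm_cexp_inner_mul_I, norm_one, le_refl]

end SpectralMeasure

section RandomConvolution

variable {E Ω : Type*} [MeasurableSpace E] [MeasurableSpace Ω] {P : Measure Ω}
  [IsProbabilityMeasure P] {V : Measure E} [SFinite V]

/-- Expectation of a random weighted average. -/
lemma integrable_integral_mul_random {H : E → Ω → ℝ} (hH : Measurable (Function.uncurry H))
    {A : ℝ} (hHi : ∀ y, Integrable (H y) P) (hA : ∀ y, ∫ ω, |H y ω| ∂P ≤ A)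
    {g : E → ℝ} (hg : Integrable g V) :
    Integrable (fun ω => ∫ y, g y * H y ω ∂V) P ∧
      ∫ ω, ∫ y, g y * H y ω ∂V ∂P = ∫ y, g y * ∫ ω, H y ω ∂P ∂V := by
  have key : Integrable (fun q : E × Ω => g q.1 * H q.1 q.2) (V.prod P) := by
    have hm : AEStronglyMeasurable (fun q : E × Ω => g q.1 * H q.1 q.2) (V.prod P) :=
      hg.aestronglyMeasurable.comp_fst.mul hH.aestronglyMeasurable
    rw [integrable_prod_iff hm]
    refine ⟨ae_of_all _ fun y => (hHi y).const_mul (g y), ?_⟩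
    refine (hg.abs.mul_const A).mono' hm.norm.integral_prod_right' (ae_of_all _ fun y => ?_)
    simp only [norm_mul, Real.norm_eq_abs]
    rw [integral_const_mul, abs_of_nonneg (by positivity)]
    exact mul_le_mul_of_nonneg_left (hA y) (abs_nonneg _)
  refine ⟨key.integral_prod_right, ?_⟩
  rw [← integral_integral_swap (f := fun y ω => g y * H y ω) key]
  simp_rw [integral_const_mul]

/-- Second moment of a pair of random weighted averages. -/
lemma integrable_integral_mul_random_mul {H H' : E → Ω → ℝ}
    (hH : Measurable (Function.uncurry H)) (hH' : Measurable (Function.uncurry H'))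
    {A : ℝ} (hHi : ∀ y y', Integrable (fun ω => H y ω * H' y' ω) P)
    (hA : ∀ y y', ∫ ω, |H y ω * H' y' ω| ∂P ≤ A)
    {g g' : E → ℝ} (hg : Integrable g V) (hg' : Integrable g' V) :
    Integrable (fun ω => (∫ y, g y * H y ω ∂V) * ∫ y, g' y * H' y ω ∂V) P ∧
      ∫ ω, (∫ y, g y * H y ω ∂V) * (∫ y, g' y * H' y ω ∂V) ∂P =
        ∫ p : E × E, g p.1 * g' p.2 * ∫ ω, H p.1 ω * H' p.2 ω ∂P ∂(V.prod V) := by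
  have hm : Measurable (Function.uncurry fun (p : E × E) ω => H p.1 ω * H' p.2 ω) :=
    (hH.comp (measurable_fst.fst.prodMk measurable_snd)).mul
      (hH'.comp (measurable_fst.snd.prodMk measurable_snd))
  have e : ∀ ω, (∫ y, g y * H y ω ∂V) * ∫ y, g' y * H' y ω ∂V =
      ∫ p : E × E, g p.1 * g' p.2 * (H p.1 ω * H' p.2 ω) ∂(V.prod V) := fun ω => by
    rw [← integral_prod_mul]
    exact integral_congr_ae (ae_of_all _ fun p => by ring)
  simp_rw [e]
  exact integrable_integral_mul_random hm (fun p => hHi p.1 p.2) (fun p => hA p.1 p.2)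
    (hg.mul_prod hg')

end RandomConvolution

section FieldCovariance

variable {E Ω : Type*} [NormedAddCommGroup E] [InnerProductSpace ℝ E] [MeasurableSpace E]
  [BorelSpace E] [SecondCountableTopology E] [MeasurableSpace Ω] {P : Measure Ω}
  [IsProbabilityMeasure P]

/-- Spectral representation of the covariance of two weighted averages of a stationary square
integrable random field. -/
lemma covariance_convolution_eq_integral_spectral {H : E → Ω → ℝ}
    (hH : Measurable (Function.uncurry H)) (hH2 : ∀ y, MemLp (H y) 2 P) {A c₀ : ℝ}
    (hA : ∀ y, ∫ ω, H y ω ^ 2 ∂P ≤ A) (hmean : ∀ y, ∫ ω, H y ω ∂P = c₀)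
    {F : Measure E} [IsFiniteMeasure F]
    (hF : ∀ y y', ((∫ ω, H y ω * H y' ω ∂P : ℝ) : ℂ) = (c₀ ^ 2 : ℝ) + charFun F (y - y'))
    {V : Measure E} [SFinite V] {g g' : E → ℝ} (hg : Integrable g V) (hg' : Integrable g' V)
    (hg1 : ∫ y, g y ∂V = 1) (hg1' : ∫ y, g' y ∂V = 1) (r : ℝ) (a b : E) :
    (((∫ ω, (r * ((∫ y, g y * H (a - y) ω ∂V) - c₀)) *
          (r * ((∫ y, g' y * H (b - y) ω ∂V) - c₀)) ∂P) -
        (∫ ω, r * ((∫ y, g y * H (a - y) ω ∂V) - c₀) ∂P) *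
          ∫ ω, r * ((∫ y, g' y * H (b - y) ω ∂V) - c₀) ∂P : ℝ) : ℂ) =
      (r ^ 2 : ℝ) * ∫ l, Complex.exp ((⟪l, a - b⟫ : ℝ) * Complex.I) *
        ((∫ y, Complex.exp (Complex.I * ((⟪y, -l⟫ : ℝ) : ℂ)) * (g y : ℂ) ∂V) *
        (∫ y, Complex.exp (Complex.I * ((⟪y, l⟫ : ℝ) : ℂ)) * (g' y : ℂ) ∂V)) ∂F := by
  have hHs : ∀ a : E, Measurable (Function.uncurry fun y => H (a - y)) := fun a =>
    hH.comp ((measurable_const.sub measurable_fst).prodMk measurable_snd)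
  have hI : ∀ y y', Integrable (fun ω => H y ω * H y' ω) P := fun y y' =>
    (hH2 y).integrable_mul (hH2 y')
  have hI1 : ∀ y, Integrable (H y) P := fun y => (hH2 y).integrable (by norm_num)
  have hsq : ∀ y, Integrable (fun ω => H y ω ^ 2) P := fun y => (hH2 y).integrable_sq
  have hAb : ∀ y y', ∫ ω, |H y ω * H y' ω| ∂P ≤ A := by
    intro y y'
    have h1 : ∫ ω, |H y ω * H y' ω| ∂P ≤ ∫ ω, (H y ω ^ 2 / 2 + H y' ω ^ 2 / 2) ∂P := by
      refine integral_mono (hI y y').abs (((hsq y).div_const 2).add ((hsq y').div_const 2))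
        fun ω => ?_
      simp only
      rw [abs_mul]
      nlinarith [sq_nonneg (|H y ω| - |H y' ω|), sq_abs (H y ω), sq_abs (H y' ω)]
    rw [integral_add ((hsq y).div_const 2) ((hsq y').div_const 2), integral_div,
      integral_div] at h1
    linarith [hA y, hA y']
  have hAb1 : ∀ y, ∫ ω, |H y ω| ∂P ≤ 1 + A := by
    intro y
    have h1 : ∫ ω, |H y ω| ∂P ≤ ∫ ω, (1 + H y ω ^ 2) ∂P := by
      refine integral_mono (hI1 y).abs ((integrable_const 1).add (hsq y)) fun ω => ?_
      simp only
      nlinarith [sq_nonneg (|H y ω| - 1), sq_abs (H y ω)]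
    rw [integral_add (integrable_const 1) (hsq y)] at h1
    simp only [integral_const, probReal_univ, smul_eq_mul, one_mul] at h1
    linarith [hA y]
  set Y : Ω → ℝ := fun ω => ∫ y, g y * H (a - y) ω ∂V with hY
  set Y' : Ω → ℝ := fun ω => ∫ y, g' y * H (b - y) ω ∂V with hY'
  obtain ⟨iY, mY⟩ := integrable_integral_mul_random (hHs a) (fun y => hI1 (a - y))
    (fun y => hAb1 (a - y)) hg
  obtain ⟨iY', mY'⟩ := integrable_integral_mul_random (hHs b) (fun y => hI1 (b - y))
    (fun y => hAb1 (b - y)) hg'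
  obtain ⟨iYY, mYY⟩ := integrable_integral_mul_random_mul (hHs a) (hHs b)
    (fun y y' => hI (a - y) (b - y')) (fun y y' => hAb (a - y) (b - y')) hg hg'
  simp_rw [hmean, integral_mul_const, hg1, one_mul] at mY
  simp_rw [hmean, integral_mul_const, hg1', one_mul] at mY'
  have e1 : ∫ ω, r * (Y ω - c₀) ∂P = 0 := by
    rw [integral_const_mul, integral_sub iY (integrable_const _), mY]
    simp
  have e2 : ∫ ω, (r * (Y ω - c₀)) * (r * (Y' ω - c₀)) ∂P =
      r ^ 2 * (∫ ω, Y ω * Y' ω ∂P - c₀ ^ 2) := by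
    have e3 : ∀ ω, (r * (Y ω - c₀)) * (r * (Y' ω - c₀)) =
        r ^ 2 * (Y ω * Y' ω - (c₀ * Y ω + c₀ * Y' ω - c₀ ^ 2)) := fun ω => by ring
    simp_rw [e3]
    have i1 : Integrable (fun ω => c₀ * Y ω + c₀ * Y' ω) P :=
      (iY.const_mul c₀).fun_add (iY'.const_mul c₀)
    have i2 : Integrable (fun ω => c₀ * Y ω + c₀ * Y' ω - c₀ ^ 2) P :=
      i1.sub (integrable_const _)
    rw [integral_const_mul, integral_sub (f := fun ω => Y ω * Y' ω) iYY i2,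
      integral_sub i1 (integrable_const _),
      integral_add (iY.const_mul c₀) (iY'.const_mul c₀), integral_const_mul, integral_const_mul,
      mY, mY']
    simp only [integral_const, probReal_univ, smul_eq_mul]
    ring
  rw [e1, zero_mul, sub_zero, e2, Complex.ofReal_mul]
  congr 1
  rw [← integral_integral_charFun hg hg', mYY, Complex.ofReal_sub, ← integral_complex_ofReal]
  have hgg : Integrable (fun p : E × E => ((g p.1 * g' p.2 : ℝ) : ℂ)) (V.prod V) :=
    (hg.mul_prod hg').ofReal
  have e4 : ∀ p : E × E, ((g p.1 * g' p.2 * ∫ ω, H (a - p.1) ω * H (b - p.2) ω ∂P : ℝ) : ℂ) =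
      ((g p.1 * g' p.2 : ℝ) : ℂ) * (c₀ ^ 2 : ℝ) +
        ((g p.1 * g' p.2 : ℝ) : ℂ) * charFun F (a - b - p.1 + p.2) := fun p => by
    rw [Complex.ofReal_mul, hF, mul_add]
    congr 4
    abel
  simp_rw [e4]
  rw [integral_add (hgg.mul_const _), integral_mul_const, integral_complex_ofReal,
    integral_prod_mul, hg1, hg1']
  · simp
  · refine hgg.mul_bdd (c := F.real Set.univ) ?_ (ae_of_all _ fun p => norm_charFun_le _)
    exact (stronglyMeasurable_charFun.measurable.comp (by fun_prop)).aestronglyMeasurable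

end FieldCovariance

/-- The covariance structure of a function of a stationary Gaussian field. -/
lemma gaussianField_function_moments {E Ω : Type*} [AddGroup E] [MeasurableSpace Ω]
    {P : Measure Ω} [IsProbabilityMeasure P] {ζ : E → Ω → ℝ} (hζ : ∀ x, Measurable (ζ x))
    (hG : ∀ (k : ℕ) (pts : Fin k → E) (c : Fin k → ℝ),
      ∃ v : NNReal, Measure.map (fun ω => ∑ i, c i * ζ (pts i) ω) P = gaussianReal 0 v)
    {R : E → ℝ} (hvar : ∀ x, ∫ ω, (ζ x ω) ^ 2 ∂P = 1)
    (hcov : ∀ x y, ∫ ω, ζ x ω * ζ y ω ∂P = R (x - y))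
    {h : ℝ → ℝ} (hm : Measurable h) (hh : MemLp h 2 (gaussianReal 0 1)) :
    (∀ x, MemLp (fun ω => h (ζ x ω)) 2 P) ∧
    (∀ x, ∫ ω, h (ζ x ω) ∂P = ∫ u, h u ∂(gaussianReal 0 1)) ∧
    (∀ x, ∫ ω, h (ζ x ω) ^ 2 ∂P = ∫ u, h u ^ 2 ∂(gaussianReal 0 1)) ∧
    ∀ x y, HasSum (fun k => (∫ u, h u * hermiteNormalized k u ∂(gaussianReal 0 1)) ^ 2 *
      R (x - y) ^ k) (∫ ω, h (ζ x ω) * h (ζ y ω) ∂P) := by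
  have hpair : ∀ x y, IsStdGaussianPair P (ζ x) (ζ y) (R (x - y)) := fun x y =>
    isStdGaussianPair_of_linear_combinations (hζ x) (hζ y)
      (fun a b => by simpa using hG 2 ![x, y] ![a, b]) (hvar x) (hvar y) (hcov x y)
  refine ⟨fun x => hh.comp_measurePreserving (hpair x x).left, fun x => ?_, fun x => ?_,
    fun x y => ?_⟩
  · rw [← (hpair x x).left.map_eq, integral_map (hζ x).aemeasurable
      hm.aestronglyMeasurable]
  · rw [← (hpair x x).left.map_eq, integral_map (hζ x).aemeasurable
      (hm.pow_const 2).aestronglyMeasurable]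
  · have : R (y - x) = R (x - y) := by
      rw [← hcov, ← hcov]; simp_rw [mul_comm]
    exact (hpair x y).hasSum_integral_mul (this ▸ hpair y x) hh

lemma summable_sq_hermite_coeff {h : ℝ → ℝ} (hh : MemLp h 2 (gaussianReal 0 1)) :
    Summable fun k => (∫ u, h u * hermiteNormalized k u ∂(gaussianReal 0 1)) ^ 2 := by
  simpa using (isStdGaussianPair_id.hasSum_integral_mul isStdGaussianPair_id hh).summable

section RegularVariation

lemma SlowlyVaryingAtTop.tendsto_div {L : ℝ → ℝ} (hL : SlowlyVaryingAtTop L) {c : ℝ} (hc : 0 < c) :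
    Tendsto (fun y => L (c * y) / L y) atTop (𝓝 1) :=
  (hL c (c + 1) hc (by linarith)).tendsto_at ⟨le_rfl, by linarith⟩

/-- Potter's bounds for slowly varying functions. -/
lemma SlowlyVaryingAtTop.potter {L : ℝ → ℝ} (hL : SlowlyVaryingAtTop L) (hpos : ∀ y > 0, 0 < L y)
    {δ : ℝ} (hδ : 0 < δ) :
    ∃ M : ℝ, 1 ≤ M ∧ ∀ u v, M ≤ u → u ≤ v →
      L v ≤ (2 * (v / u)) ^ δ * L u ∧ L u ≤ (2 * (v / u)) ^ δ * L v := by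
  set η : ℝ := 2 ^ δ with hη
  have hη1 : 1 < η := Real.one_lt_rpow (by norm_num) hδ
  have hη0 : 0 < η := by linarith
  have hinv : η⁻¹ < 1 := inv_lt_one_of_one_lt₀ hη1
  have hunif := Metric.tendstoUniformlyOn_iff.1 (hL (1 / 2) 2 (by norm_num) (by norm_num))
    (min (η - 1) (1 - η⁻¹)) (lt_min (by linarith) (by linarith))
  obtain ⟨M₀, hM₀⟩ := eventually_atTop.1 hunif
  set M := max M₀ 1
  have hM1 : 1 ≤ M := le_max_right _ _
  have step : ∀ u, M ≤ u → ∀ v, u ≤ v → v ≤ 2 * u → L v ≤ η * L u ∧ L u ≤ η * L v := by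
    intro u hu v huv hv
    have hu0 : 0 < u := by linarith
    have h1 := hM₀ u ((le_max_left _ _).trans hu) (v / u)
      ⟨by rw [le_div_iff₀ hu0]; linarith, by rw [div_le_iff₀ hu0]; linarith⟩
    rw [div_mul_cancel₀ _ hu0.ne', Real.dist_eq, abs_lt] at h1
    have hLu := hpos u hu0
    have hLv := hpos v (by linarith)
    have h2 : L v / L u < η := by linarith [h1.1, min_le_left (η - 1) (1 - η⁻¹)]
    have h3 : η⁻¹ < L v / L u := by linarith [h1.2, min_le_right (η - 1) (1 - η⁻¹)]
    rw [div_lt_iff₀ hLu] at h2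
    rw [lt_div_iff₀ hLu, inv_mul_lt_iff₀ hη0] at h3
    exact ⟨h2.le, h3.le⟩
  have iter : ∀ k : ℕ, ∀ u, M ≤ u → ∀ v, u ≤ v → v ≤ 2 ^ k * u →
      L v ≤ η ^ k * L u ∧ L u ≤ η ^ k * L v := by
    intro k
    induction k with
    | zero =>
      intro u hu v huv hv
      have : v = u := le_antisymm (by simpa using hv) huv
      simp [this]
    | succ k ih =>
      intro u hu v huv hv
      have hu0 : 0 < u := by linarith
      have hLu := hpos u hu0
      have hLv := hpos v (by linarith)
      have hk : η ^ k ≤ η ^ (k + 1) := pow_le_pow_right₀ hη1.le (by omega)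
      rcases le_total v (2 ^ k * u) with h | h
      · obtain ⟨h1, h2⟩ := ih u hu v huv h
        exact ⟨h1.trans (by gcongr), h2.trans (by gcongr)⟩
      · have hw : u ≤ 2 ^ k * u := le_mul_of_one_le_left hu0.le (one_le_pow₀ (by norm_num))
        obtain ⟨h1, h2⟩ := ih u hu (2 ^ k * u) hw le_rfl
        obtain ⟨h3, h4⟩ := step (2 ^ k * u) (hu.trans hw) v h (by rw [pow_succ] at hv; linarith)
        refine ⟨h3.trans ?_, h2.trans ?_⟩
        · rw [pow_succ', mul_assoc]; gcongr
        · rw [pow_succ, mul_assoc]; gcongr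
  refine ⟨M, hM1, fun u v hu huv => ?_⟩
  have hu0 : 0 < u := by linarith
  have hq : 1 ≤ v / u := by rw [le_div_iff₀ hu0]; linarith
  obtain ⟨k, hk1, hk2⟩ := exists_nat_pow_near hq (by norm_num : (1 : ℝ) < 2)
  obtain ⟨h1, h2⟩ := iter (k + 1) u hu v huv (by rw [div_lt_iff₀ hu0] at hk2; exact hk2.le)
  have h3 : η ^ (k + 1) ≤ (2 * (v / u)) ^ δ := by
    rw [hη, ← Real.rpow_natCast, ← Real.rpow_mul (by norm_num), mul_comm,
      Real.rpow_mul (by norm_num), Real.rpow_natCast]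
    refine Real.rpow_le_rpow (by positivity) ?_ hδ.le
    rw [pow_succ']; gcongr
  have hLu := hpos u hu0
  have hLv := hpos v (by linarith)
  exact ⟨h1.trans (by gcongr), h2.trans (by gcongr)⟩

lemma eventually_comap_norm_atTop {E : Type*} [NormedAddCommGroup E] {p : E → Prop}
    (h : ∀ᶠ z in comap norm atTop, p z) :
    ∃ M : ℝ, ∀ z, M ≤ ‖z‖ → p z := by
  obtain ⟨s, hs, hp⟩ := h
  obtain ⟨M, hM⟩ := mem_atTop_sets.1 hs
  exact ⟨M, fun z hz => hp (hM _ hz)⟩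

lemma tendsto_zero_of_regularlyVarying {E : Type*} [NormedAddCommGroup E] {R : E → ℝ}
    {L : ℝ → ℝ} {κ : ℝ} (hL : SlowlyVaryingAtTop L) (hpos : ∀ y > 0, 0 < L y)
    (hκ : 0 < κ)
    (hR : Tendsto (fun z : E => R z * ‖z‖ ^ κ / L ‖z‖) (comap norm atTop) (𝓝 1)) :
    Tendsto R (comap norm atTop) (𝓝 0) := by
  obtain ⟨M, hM1, hM⟩ := hL.potter hpos (half_pos hκ)
  have hLM := hpos M (by linarith)
  have h1 : Tendsto (fun r : ℝ => L r / r ^ κ) atTop (𝓝 0) := by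
    have h2 : Tendsto (fun r : ℝ => (2 / M) ^ (κ / 2) * L M * r ^ (-(κ / 2))) atTop (𝓝 0) := by
      simpa using (tendsto_rpow_neg_atTop (half_pos hκ)).const_mul ((2 / M) ^ (κ / 2) * L M)
    refine squeeze_zero' ?_ ?_ h2
    · filter_upwards [eventually_gt_atTop 0] with r hr
      have := hpos r hr
      positivity
    · filter_upwards [eventually_ge_atTop M] with r hr
      have hr0 : 0 < r := by linarith
      rw [div_le_iff₀ (by positivity), mul_assoc, ← Real.rpow_add hr0,
        show -(κ / 2) + κ = κ / 2 by ring]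
      refine (hM M r le_rfl hr).1.trans (le_of_eq ?_)
      rw [show 2 * (r / M) = (2 / M) * r by ring, Real.mul_rpow (by positivity) hr0.le]
      ring
  have h3 := hR.mul (h1.comp (tendsto_comap (f := (norm : E → ℝ))))
  rw [mul_zero] at h3
  refine h3.congr' ?_
  have : ∀ᶠ z : E in comap norm atTop, 0 < ‖z‖ := tendsto_comap.eventually (eventually_gt_atTop 0)
  filter_upwards [this] with z hz
  have h4 := (hpos _ hz).ne'
  have h5 := (Real.rpow_pos_of_pos hz κ).ne'
  simp only [Function.comp_apply]
  field_simp

variable {E : Type*} [NormedAddCommGroup E] [NormedSpace ℝ E] {R : E → ℝ} {L : ℝ → ℝ} {κ : ℝ}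

/-- A uniform bound for the rescaled regularly varying function. -/
lemma exists_bound_rescaled (hL : SlowlyVaryingAtTop L) (hpos : ∀ y > 0, 0 < L y)
    (hκ : 0 < κ) (hR1 : ∀ z, |R z| ≤ 1)
    (hR : Tendsto (fun z : E => R z * ‖z‖ ^ κ / L ‖z‖) (comap norm atTop) (𝓝 1))
    {δ : ℝ} (hδ : 0 < δ) (hδκ : δ ≤ κ) :
    ∃ K T₀ : ℝ, 0 < K ∧ ∀ T, T₀ ≤ T → ∀ z : E, z ≠ 0 →
      |R (T • z) * T ^ κ / L T| ≤ K * (‖z‖ ^ (-(κ + δ)) + 1) := by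
  obtain ⟨M, hM1, hM⟩ := hL.potter hpos hδ
  have hev : ∀ᶠ z in comap norm atTop, |R z * ‖z‖ ^ κ / L ‖z‖| < 2 :=
    (hR.abs).eventually (gt_mem_nhds (by norm_num))
  obtain ⟨M', hM'⟩ := eventually_comap_norm_atTop hev
  set M₁ := max M M' with hM₁
  have h1 : 1 ≤ M₁ := hM1.trans (le_max_left _ _)
  have hLM := hpos M₁ (by linarith)
  set K₁ : ℝ := 2 * 2 ^ δ with hK₁
  set K₂ : ℝ := (2 / M₁) ^ δ / L M₁ * M₁ ^ (κ + δ) with hK₂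
  have hK₁0 : 0 < K₁ := by positivity
  have hK₂0 : 0 < K₂ := by positivity
  refine ⟨K₁ + K₂, M₁, by positivity, fun T hT z hz => ?_⟩
  have hT0 : 0 < T := by linarith
  have hz0 : 0 < ‖z‖ := norm_pos_iff.2 hz
  have hLT := hpos T hT0
  have hzq : 0 < ‖z‖ ^ (-(κ + δ)) := Real.rpow_pos_of_pos hz0 _
  have hnorm : ‖T • z‖ = T * ‖z‖ := by rw [norm_smul, Real.norm_of_nonneg hT0.le]
  rw [abs_div, abs_mul, abs_of_pos hLT, abs_of_pos (Real.rpow_pos_of_pos hT0 κ)]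
  rcases lt_or_ge (T * ‖z‖) M₁ with hlt | hge
  · obtain ⟨-, h2⟩ := hM M₁ T (le_max_left _ _) hT
    have h3 : T ≤ M₁ / ‖z‖ := by rw [le_div_iff₀ hz0]; exact hlt.le
    have h4 : |R (T • z)| * T ^ κ / L T ≤ K₂ * ‖z‖ ^ (-(κ + δ)) := by
      calc |R (T • z)| * T ^ κ / L T ≤ 1 * T ^ κ / L T := by
            have := hR1 (T • z); gcongr
        _ ≤ T ^ κ * ((2 * (T / M₁)) ^ δ / L M₁) := by
            rw [one_mul, div_eq_mul_inv]
            gcongr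
            rw [inv_le_comm₀ hLT (by positivity), inv_div, div_le_iff₀ (by positivity), mul_comm]
            exact h2
        _ = (2 / M₁) ^ δ / L M₁ * T ^ (κ + δ) := by
            rw [show 2 * (T / M₁) = (2 / M₁) * T by ring, Real.mul_rpow (by positivity) hT0.le,
              Real.rpow_add hT0]
            ring
        _ ≤ (2 / M₁) ^ δ / L M₁ * (M₁ / ‖z‖) ^ (κ + δ) := by
            gcongr
        _ = K₂ * ‖z‖ ^ (-(κ + δ)) := by
            rw [hK₂, Real.div_rpow (by linarith) hz0.le, Real.rpow_neg hz0.le]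
            ring
    nlinarith
  · have h2 := hM' (T • z) (by rw [hnorm]; exact (le_max_right _ _).trans hge)
    rw [hnorm] at h2
    have hTz : 0 < T * ‖z‖ := by positivity
    have hLTz := hpos _ hTz
    rw [abs_div, abs_mul, abs_of_pos hLTz, abs_of_pos (Real.rpow_pos_of_pos hTz κ),
      div_lt_iff₀ hLTz, Real.mul_rpow hT0.le hz0.le, ← mul_assoc] at h2
    have hzκ : 0 < ‖z‖ ^ κ := Real.rpow_pos_of_pos hz0 κ
    have h3 : |R (T • z)| * T ^ κ / L T ≤ 2 * (L (T * ‖z‖) / L T) * ‖z‖ ^ (-κ) := by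
      rw [Real.rpow_neg hz0.le, ← div_eq_mul_inv, le_div_iff₀ hzκ, div_mul_eq_mul_div,
        mul_div_assoc', div_le_div_iff_of_pos_right hLT]
      exact h2.le
    have hM_le : M ≤ M₁ := le_max_left _ _
    rcases le_total ‖z‖ 1 with hz1 | hz1
    · obtain ⟨-, h4⟩ := hM (T * ‖z‖) T (hM_le.trans hge) (mul_le_of_le_one_right hT0.le hz1)
      have h5 : L (T * ‖z‖) / L T ≤ 2 ^ δ * ‖z‖ ^ (-δ) := by
        rw [div_le_iff₀ hLT]
        refine h4.trans (le_of_eq ?_)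
        rw [show T / (T * ‖z‖) = ‖z‖⁻¹ by field_simp, Real.mul_rpow (by norm_num) (by positivity),
          Real.inv_rpow hz0.le, Real.rpow_neg hz0.le]
      have h6 : |R (T • z)| * T ^ κ / L T ≤ K₁ * ‖z‖ ^ (-(κ + δ)) := by
        refine h3.trans ?_
        calc 2 * (L (T * ‖z‖) / L T) * ‖z‖ ^ (-κ) ≤ 2 * (2 ^ δ * ‖z‖ ^ (-δ)) * ‖z‖ ^ (-κ) := by
              gcongr
          _ = K₁ * ‖z‖ ^ (-(κ + δ)) := by
              rw [hK₁, show -(κ + δ) = -δ + -κ by ring, Real.rpow_add hz0]; ring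
      nlinarith
    · obtain ⟨h4, -⟩ := hM T (T * ‖z‖) (hM_le.trans hT) (le_mul_of_one_le_right hT0.le hz1)
      have h5 : L (T * ‖z‖) / L T ≤ 2 ^ δ * ‖z‖ ^ δ := by
        rw [div_le_iff₀ hLT]
        refine h4.trans (le_of_eq ?_)
        rw [show T * ‖z‖ / T = ‖z‖ by field_simp, Real.mul_rpow (by norm_num) (by positivity)]
      have h6 : |R (T • z)| * T ^ κ / L T ≤ K₁ := by
        refine h3.trans ?_
        calc 2 * (L (T * ‖z‖) / L T) * ‖z‖ ^ (-κ) ≤ 2 * (2 ^ δ * ‖z‖ ^ δ) * ‖z‖ ^ (-κ) := by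
              gcongr
          _ = K₁ * ‖z‖ ^ (δ - κ) := by
              rw [hK₁, show δ - κ = δ + -κ by ring, Real.rpow_add hz0]; ring
          _ ≤ K₁ * 1 := by
              gcongr
              exact Real.rpow_le_one_of_one_le_of_nonpos hz1 (by linarith)
          _ = K₁ := mul_one _
      nlinarith

lemma tendsto_smul_comap_norm {z : E} (hz : z ≠ 0) :
    Tendsto (fun T : ℝ => T • z) atTop (comap norm atTop) := by
  rw [tendsto_comap_iff]
  have h : Tendsto (fun T : ℝ => T * ‖z‖) atTop atTop :=
    tendsto_id.atTop_mul_const (norm_pos_iff.2 hz)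
  refine h.congr' ?_
  filter_upwards [eventually_ge_atTop 0] with T hT
  simp [norm_smul, abs_of_nonneg hT]

lemma tendsto_rescaled (hL : SlowlyVaryingAtTop L) (hpos : ∀ y > 0, 0 < L y)
    (hR : Tendsto (fun z : E => R z * ‖z‖ ^ κ / L ‖z‖) (comap norm atTop) (𝓝 1))
    {z : E} (hz : z ≠ 0) :
    Tendsto (fun T : ℝ => R (T • z) * T ^ κ / L T) atTop (𝓝 (‖z‖ ^ (-κ))) := by
  have hz0 : 0 < ‖z‖ := norm_pos_iff.2 hz
  have h := ((hR.comp (tendsto_smul_comap_norm hz)).mul (hL.tendsto_div hz0)).mul_const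
    (‖z‖ ^ (-κ))
  simp only [one_mul] at h
  refine h.congr' ?_
  filter_upwards [eventually_gt_atTop 0] with T hT
  have hnorm : ‖T • z‖ = T * ‖z‖ := by rw [norm_smul, Real.norm_of_nonneg hT.le]
  have h1 := (hpos T hT).ne'
  have h2 := (hpos (T * ‖z‖) (by positivity)).ne'
  have h3 := (Real.rpow_pos_of_pos hz0 κ).ne'
  simp only [Function.comp_apply]
  rw [hnorm, mul_comm ‖z‖ T, Real.mul_rpow hT.le hz0.le, Real.rpow_neg hz0.le]
  field_simp

end RegularVariation

section PowerSeries

variable {c : ℕ → ℝ} {m : ℕ}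

lemma summable_mul_pow_of_abs_le_one (hc0 : ∀ k, 0 ≤ c k) (hc : Summable c) {r : ℝ}
    (hr : |r| ≤ 1) : Summable fun k => c k * r ^ k := by
  refine Summable.of_norm_bounded hc fun k => ?_
  rw [Real.norm_eq_abs, abs_mul, abs_pow, abs_of_nonneg (hc0 k)]
  exact mul_le_of_le_one_right (hc0 k) (pow_le_one₀ (abs_nonneg _) hr)

lemma abs_tsum_mul_pow_le (hc0 : ∀ k, 0 ≤ c k) (hc : Summable c) (hm : ∀ k < m, c k = 0) {r : ℝ}
    (hr : |r| ≤ 1) : |∑' k, c k * r ^ k| ≤ (∑' k, c k) * |r| ^ m := by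
  rw [← tsum_mul_right]
  refine tsum_of_norm_bounded (f := fun k => c k * r ^ k) (hc.mul_right _).hasSum fun k => ?_
  rw [Real.norm_eq_abs, abs_mul, abs_pow, abs_of_nonneg (hc0 k)]
  rcases lt_or_ge k m with h | h
  · simp [hm k h]
  · exact mul_le_mul_of_nonneg_left (pow_le_pow_of_le_one (abs_nonneg _) hr h) (hc0 k)

lemma abs_tsum_mul_pow_sub_le (hc0 : ∀ k, 0 ≤ c k) (hc : Summable c) (hm : ∀ k < m, c k = 0)
    {r : ℝ} (hr : |r| ≤ 1) :
    |∑' k, c k * r ^ k - c m * r ^ m| ≤ (∑' k, c k) * |r| ^ (m + 1) := by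
  have hs := summable_mul_pow_of_abs_le_one hc0 hc hr
  have h2 : ∑' k, c k * r ^ k - c m * r ^ m = ∑' k, Function.update c m 0 k * r ^ k := by
    rw [hs.tsum_eq_add_tsum_ite m, add_sub_cancel_left]
    refine tsum_congr fun k => ?_
    by_cases hk : k = m
    · simp [hk]
    · simp [hk]
  have hle : ∀ k, Function.update c m 0 k ≤ c k := fun k => by
    by_cases hk : k = m
    · subst hk; simpa using hc0 k
    · simp [hk]
  have h0 : ∀ k, 0 ≤ Function.update c m 0 k := fun k => by
    by_cases hk : k = m
    · subst hk; simp
    · simpa [hk] using hc0 k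
  have hsum : Summable (Function.update c m 0) := hc.of_nonneg_of_le h0 hle
  rw [h2]
  refine (abs_tsum_mul_pow_le (m := m + 1) h0 hsum (fun k hk => ?_) hr).trans ?_
  · by_cases hkm : k = m
    · simp [hkm]
    · simp [hkm, hm k (by omega)]
  · exact mul_le_mul_of_nonneg_right (hsum.tsum_le_tsum hle hc) (by positivity)

end PowerSeries

section RescaledSeries

variable {E : Type*} [NormedAddCommGroup E] [NormedSpace ℝ E] {R : E → ℝ} {L : ℝ → ℝ} {κ : ℝ}
  {c : ℕ → ℝ} {m : ℕ}

lemma rescaled_pow_eq {T : ℝ} (hT : 0 < T) (r l : ℝ) :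
    r ^ m / (T ^ (-κ) * l) ^ m = (r * T ^ κ / l) ^ m := by
  have := (Real.rpow_pos_of_pos hT κ).ne'
  rw [← div_pow, Real.rpow_neg hT.le]
  congr 1
  field_simp

lemma exists_bound_rescaled_tsum (hc0 : ∀ k, 0 ≤ c k) (hc : Summable c) (hm : ∀ k < m, c k = 0)
    (hL : SlowlyVaryingAtTop L) (hpos : ∀ y > 0, 0 < L y) (hκ : 0 < κ) (hR1 : ∀ z, |R z| ≤ 1)
    (hR : Tendsto (fun z : E => R z * ‖z‖ ^ κ / L ‖z‖) (comap norm atTop) (𝓝 1))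
    {δ : ℝ} (hδ : 0 < δ) (hδκ : δ ≤ κ) :
    ∃ K T₀ : ℝ, 0 ≤ K ∧ ∀ T, T₀ ≤ T → ∀ z : E, z ≠ 0 →
      |(∑' k, c k * R (T • z) ^ k) / (T ^ (-κ) * L T) ^ m| ≤
        K * (‖z‖ ^ (-(m * (κ + δ))) + 1) := by
  obtain ⟨K, T₀, hK, hb⟩ := exists_bound_rescaled hL hpos hκ hR1 hR hδ hδκ
  have hA : 0 ≤ ∑' k, c k := tsum_nonneg hc0
  refine ⟨(∑' k, c k) * (K ^ m * 2 ^ m), max T₀ 1, by positivity, fun T hT z hz => ?_⟩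
  have hT0 : 0 < T := lt_of_lt_of_le one_pos ((le_max_right _ _).trans hT)
  have hLT := hpos T hT0
  have hz0 : 0 < ‖z‖ := norm_pos_iff.2 hz
  have h1 := hb T ((le_max_left _ _).trans hT) z hz
  have hd : 0 < (T ^ (-κ) * L T) ^ m := by positivity
  rw [abs_div, abs_of_pos hd]
  set w := ‖z‖ ^ (-(κ + δ)) with hw
  have hw0 : 0 < w := Real.rpow_pos_of_pos hz0 _
  have hwm : ‖z‖ ^ (-(m * (κ + δ))) = w ^ m := by
    rw [hw, ← Real.rpow_natCast, ← Real.rpow_mul hz0.le]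
    ring_nf
  calc |∑' k, c k * R (T • z) ^ k| / (T ^ (-κ) * L T) ^ m
      ≤ (∑' k, c k) * |R (T • z)| ^ m / (T ^ (-κ) * L T) ^ m := by
        gcongr
        exact abs_tsum_mul_pow_le hc0 hc hm (hR1 _)
    _ = (∑' k, c k) * |R (T • z) * T ^ κ / L T| ^ m := by
        rw [mul_div_assoc, rescaled_pow_eq hT0, abs_div, abs_mul, abs_of_pos hLT,
          abs_of_pos (Real.rpow_pos_of_pos hT0 κ)]
    _ ≤ (∑' k, c k) * (K * (w + 1)) ^ m := by gcongr
    _ ≤ (∑' k, c k) * (K ^ m * (2 ^ m * (w ^ m + 1))) := by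
        rw [mul_pow]
        gcongr
        calc (w + 1) ^ m ≤ (2 * max w 1) ^ m := by
              gcongr
              linarith [le_max_left w 1, le_max_right w 1]
          _ = 2 ^ m * (max w 1) ^ m := mul_pow _ _ _
          _ ≤ 2 ^ m * (w ^ m + 1) := by
              gcongr
              rcases max_cases w 1 with ⟨h, _⟩ | ⟨h, _⟩
              · rw [h]; linarith
              · rw [h]; have := pow_pos hw0 m; simp; linarith
    _ = (∑' k, c k) * (K ^ m * 2 ^ m) * (‖z‖ ^ (-(m * (κ + δ))) + 1) := by rw [hwm]; ring

lemma tendsto_rescaled_tsum (hc0 : ∀ k, 0 ≤ c k) (hc : Summable c) (hm : ∀ k < m, c k = 0)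
    (hL : SlowlyVaryingAtTop L) (hpos : ∀ y > 0, 0 < L y) (hκ : 0 < κ) (hR1 : ∀ z, |R z| ≤ 1)
    (hR : Tendsto (fun z : E => R z * ‖z‖ ^ κ / L ‖z‖) (comap norm atTop) (𝓝 1))
    {z : E} (hz : z ≠ 0) :
    Tendsto (fun T : ℝ => (∑' k, c k * R (T • z) ^ k) / (T ^ (-κ) * L T) ^ m) atTop
      (𝓝 (c m * ‖z‖ ^ (-(m * κ)))) := by
  have h1 := (tendsto_rescaled hL hpos hR hz).pow m
  have h2 : Tendsto (fun T : ℝ => R (T • z)) atTop (𝓝 0) :=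
    (tendsto_zero_of_regularlyVarying hL hpos hκ hR).comp (tendsto_smul_comap_norm hz)
  have hzm : (‖z‖ ^ (-κ)) ^ m = ‖z‖ ^ (-(m * κ)) := by
    rw [← Real.rpow_natCast, ← Real.rpow_mul (norm_nonneg _)]
    ring_nf
  rw [hzm] at h1
  have h3 : Tendsto (fun T : ℝ => (∑' k, c k) * |R (T • z)| * |(R (T • z) * T ^ κ / L T) ^ m|)
      atTop (𝓝 0) := by
    simpa using (h2.abs.const_mul (∑' k, c k)).mul h1.abs
  rw [tendsto_iff_dist_tendsto_zero]
  have h4 : Tendsto (fun T : ℝ => dist (c m * (R (T • z) * T ^ κ / L T) ^ m)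
      (c m * ‖z‖ ^ (-(m * κ)))) atTop (𝓝 0) := tendsto_iff_dist_tendsto_zero.1 (h1.const_mul (c m))
  have h5 := h3.add h4
  rw [add_zero] at h5
  refine squeeze_zero' (Eventually.of_forall fun _ => dist_nonneg) ?_ h5
  filter_upwards [eventually_gt_atTop 0] with T hT
  refine (dist_triangle _ (c m * (R (T • z) * T ^ κ / L T) ^ m) _).trans ?_
  gcongr
  have hLT := hpos T hT
  have hd : 0 < (T ^ (-κ) * L T) ^ m := by positivity
  rw [Real.dist_eq, ← rescaled_pow_eq hT, ← mul_div_assoc, ← sub_div, abs_div, abs_of_pos hd,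
    abs_div, abs_of_pos hd, abs_pow, ← mul_div_assoc]
  gcongr
  refine (abs_tsum_mul_pow_sub_le hc0 hc hm (hR1 _)).trans (le_of_eq ?_)
  rw [pow_succ]; ring

end RescaledSeries

section Kernels

variable {E : Type*} [NormedAddCommGroup E] [InnerProductSpace ℝ E]

/-- The heat kernel. -/
noncomputable def heatKernel (s : ℝ) (z : E) : ℝ :=
  (4 * Real.pi * s) ^ (-((Module.finrank ℝ E : ℝ) / 2)) * Real.exp (-(‖z‖ ^ 2 / (4 * s)))

lemma heatKernel_nonneg {s : ℝ} (hs : 0 ≤ s) (z : E) : 0 ≤ heatKernel s z := by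
  unfold heatKernel; positivity

lemma heatKernel_le {s : ℝ} (hs : 0 ≤ s) (z : E) :
    heatKernel s z ≤ (4 * Real.pi * s) ^ (-((Module.finrank ℝ E : ℝ) / 2)) := by
  unfold heatKernel
  refine mul_le_of_le_one_right (by positivity) (Real.exp_le_one_iff.2 ?_)
  rw [neg_nonpos]; positivity

/-- The weight of the Gaussian mixture defining the Bessel kernel. -/
noncomputable def gammaWeight (d s : ℝ) : ℝ := s ^ (d - 1) * Real.exp (-s) / Real.Gamma d

lemma gammaWeight_nonneg {d s : ℝ} (hd : 0 < d) (hs : 0 ≤ s) : 0 ≤ gammaWeight d s := by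
  have := Real.Gamma_pos_of_pos hd
  unfold gammaWeight; positivity

lemma integrableOn_gammaWeight {d : ℝ} (hd : 0 < d) :
    IntegrableOn (gammaWeight d) (Set.Ioi 0) := by
  unfold gammaWeight
  have h := Real.GammaIntegral_convergent hd
  simp only [mul_comm (Real.exp _)] at h
  exact Integrable.div_const h _

lemma measurable_gammaWeight (d : ℝ) : Measurable (gammaWeight d) := by
  unfold gammaWeight; fun_prop

lemma integral_gammaWeight_mul_exp {d r : ℝ} (hd : 0 < d) (hr : 0 ≤ r) :
    ∫ s in Set.Ioi 0, gammaWeight d s * Real.exp (-(s * r)) = (1 + r) ^ (-d) := by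
  have e : ∀ s, gammaWeight d s * Real.exp (-(s * r)) =
      s ^ (d - 1) * Real.exp (-((1 + r) * s)) / Real.Gamma d := fun s => by
    rw [gammaWeight, div_mul_eq_mul_div, mul_assoc, ← Real.exp_add]
    ring_nf
  simp_rw [e]
  rw [integral_div, Real.integral_rpow_mul_exp_neg_mul_Ioi hd (by linarith),
    mul_div_cancel_right₀ _ (Real.Gamma_pos_of_pos hd).ne', one_div,
    Real.inv_rpow (by linarith), Real.rpow_neg (by linarith)]

lemma measurable_heatKernel [MeasurableSpace E] [BorelSpace E] :
    Measurable fun q : E × ℝ => heatKernel q.2 q.1 := by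
  unfold heatKernel; fun_prop

variable [FiniteDimensional ℝ E]

/-- The Bessel kernel, whose transform is `(1 + ‖l‖²)⁻ᵈ` with `d` the dimension. -/
noncomputable def besselKernel (z : E) : ℝ :=
  ∫ s in Set.Ioi 0, gammaWeight (Module.finrank ℝ E) s * heatKernel s z

lemma besselKernel_nonneg [Nontrivial E] (z : E) : 0 ≤ besselKernel z := by
  have hd : (0 : ℝ) < Module.finrank ℝ E := by exact_mod_cast Module.finrank_pos
  exact setIntegral_nonneg measurableSet_Ioi fun s hs =>
    mul_nonneg (gammaWeight_nonneg hd (le_of_lt hs)) (heatKernel_nonneg (le_of_lt hs) z)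

lemma exists_besselKernel_le [Nontrivial E] : ∃ K : ℝ, ∀ z : E, besselKernel z ≤ K := by
  have hd : (0 : ℝ) < Module.finrank ℝ E := by exact_mod_cast Module.finrank_pos
  refine ⟨∫ s in Set.Ioi 0, gammaWeight (Module.finrank ℝ E) s *
    (4 * Real.pi * s) ^ (-((Module.finrank ℝ E : ℝ) / 2)), fun z => ?_⟩
  refine integral_mono_of_nonneg ?_ ?_ ?_
  · filter_upwards [ae_restrict_mem measurableSet_Ioi] with s hs
    exact mul_nonneg (gammaWeight_nonneg hd (le_of_lt hs)) (heatKernel_nonneg (le_of_lt hs) z)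
  · refine IntegrableOn.congr_fun (f := fun s => ((4 * Real.pi) ^
      (-((Module.finrank ℝ E : ℝ) / 2)) / Real.Gamma (Module.finrank ℝ E)) *
      (Real.exp (-s) * s ^ ((Module.finrank ℝ E : ℝ) / 2 - 1)))
      ((Real.GammaIntegral_convergent (half_pos hd)).const_mul _) ?_ measurableSet_Ioi
    intro s hs
    simp only [gammaWeight]
    rw [Real.mul_rpow (by positivity) (le_of_lt hs), show (Module.finrank ℝ E : ℝ) / 2 - 1 =
      (Module.finrank ℝ E - 1) + -((Module.finrank ℝ E : ℝ) / 2) by ring, Real.rpow_add hs]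
    ring
  · filter_upwards [ae_restrict_mem measurableSet_Ioi] with s hs
    exact mul_le_mul_of_nonneg_left (heatKernel_le (le_of_lt hs) z)
      (gammaWeight_nonneg hd (le_of_lt hs))

variable [MeasurableSpace E] [BorelSpace E]

/-- The transform of an integrable function against a finite measure, expressed through the
characteristic function of the measure. -/
lemma integral_transform_eq_integral_charFun {ν : Measure E} [IsFiniteMeasure ν]
    {k : E → ℝ} (hk : Integrable k) (u : E) :
    ∫ l, Complex.exp ((⟪l, u⟫ : ℝ) * Complex.I) *
        (∫ z, Complex.exp ((⟪z, l⟫ : ℝ) * Complex.I) * (k z : ℂ)) ∂ν =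
      ∫ z, (k z : ℂ) * charFun ν (z + u) := by
  have e : ∀ z, (k z : ℂ) * charFun ν (z + u) =
      ∫ l, (k z : ℂ) * Complex.exp ((⟪l, z + u⟫ : ℝ) * Complex.I) ∂ν := fun z => by
    rw [charFun_apply, integral_const_mul]
  simp_rw [e]
  rw [integral_integral_swap]
  · refine integral_congr_ae (ae_of_all _ fun l => ?_)
    simp only
    rw [← integral_const_mul]
    refine integral_congr_ae (ae_of_all _ fun z => ?_)
    simp only [inner_add_right, Complex.ofReal_add, add_mul, Complex.exp_add, real_inner_comm l]
    ring
  · have h1 : Integrable (fun q : E × E => (k q.1 : ℂ) * 1) (volume.prod ν) :=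
      (hk.ofReal (𝕜 := ℂ)).mul_prod (integrable_const (1 : ℂ))
    refine h1.norm.mono' ?_ (ae_of_all _ fun q => ?_)
    · have h2 := h1.aestronglyMeasurable
      simp only [mul_one] at h2
      exact h2.mul (by fun_prop)
    · simp only [Function.uncurry, norm_mul, norm_cexp_inner_mul_I, norm_one, le_refl]

lemma integrable_heatKernel {s : ℝ} (hs : 0 < s) : Integrable (heatKernel s : E → ℝ) := by
  have h := (GaussianFourier.integrable_cexp_neg_mul_sq_norm_add (V := E)
    (b := ((1 / (4 * s) : ℝ) : ℂ)) (by rw [Complex.ofReal_re]; positivity) 0 0).norm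
  unfold heatKernel
  refine (h.congr (ae_of_all _ fun z => ?_)).const_mul _
  simp only [zero_mul, add_zero]
  rw [Complex.norm_exp]
  congr 1
  rw [← Complex.ofReal_pow, ← Complex.ofReal_neg, ← Complex.ofReal_mul, Complex.ofReal_re]
  ring

lemma integral_cexp_mul_heatKernel {s : ℝ} (hs : 0 < s) (l : E) :
    ∫ z, Complex.exp ((⟪z, l⟫ : ℝ) * Complex.I) * (heatKernel s z : ℂ) =
      (Real.exp (-(s * ‖l‖ ^ 2)) : ℝ) := by
  have h := GaussianFourier.integral_cexp_neg_mul_sq_norm_add (V := E)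
    (b := ((1 / (4 * s) : ℝ) : ℂ)) (by rw [Complex.ofReal_re]; positivity) Complex.I l
  have e : ∀ z : E, Complex.exp ((⟪z, l⟫ : ℝ) * Complex.I) * (heatKernel s z : ℂ) =
      (((4 * Real.pi * s) ^ (-((Module.finrank ℝ E : ℝ) / 2)) : ℝ) : ℂ) *
        Complex.exp (-((1 / (4 * s) : ℝ) : ℂ) * ‖z‖ ^ 2 + Complex.I * (⟪l, z⟫ : ℝ)) := by
    intro z
    rw [heatKernel, Complex.ofReal_mul, Complex.ofReal_exp, Complex.exp_add, real_inner_comm]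
    have : ((-(‖z‖ ^ 2 / (4 * s)) : ℝ) : ℂ) = -((1 / (4 * s) : ℝ) : ℂ) * ‖z‖ ^ 2 := by
      push_cast; ring
    rw [this]; ring_nf
  simp_rw [e]
  rw [integral_const_mul, h]
  have e2 : ((Real.pi : ℂ) / ((1 / (4 * s) : ℝ) : ℂ)) ^ ((Module.finrank ℝ E : ℂ) / 2) =
      (((4 * Real.pi * s) ^ ((Module.finrank ℝ E : ℝ) / 2) : ℝ) : ℂ) := by
    rw [Complex.ofReal_cpow (by positivity)]
    push_cast
    congr 1
    have : (s : ℂ) ≠ 0 := by exact_mod_cast hs.ne'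
    field_simp
  have e3 : Complex.exp (Complex.I ^ 2 * ‖l‖ ^ 2 / (4 * ((1 / (4 * s) : ℝ) : ℂ))) =
      ((Real.exp (-(s * ‖l‖ ^ 2)) : ℝ) : ℂ) := by
    rw [Complex.ofReal_exp, Complex.I_sq]
    push_cast
    congr 1
    have : (s : ℂ) ≠ 0 := by exact_mod_cast hs.ne'
    field_simp
  rw [e2, e3, ← mul_assoc, ← Complex.ofReal_mul, ← Real.rpow_add (by positivity)]
  simp

lemma integral_heatKernel {s : ℝ} (hs : 0 < s) : ∫ z : E, heatKernel s z = 1 := by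
  have h := integral_cexp_mul_heatKernel hs (0 : E)
  simp only [inner_zero_right, Complex.ofReal_zero, zero_mul, Complex.exp_zero, one_mul,
    integral_complex_ofReal] at h
  simpa using h

lemma integrable_gammaWeight_mul_heatKernel [Nontrivial E] :
    Integrable (fun q : E × ℝ => gammaWeight (Module.finrank ℝ E) q.2 * heatKernel q.2 q.1)
      (volume.prod (volume.restrict (Set.Ioi 0))) := by
  have hd : (0 : ℝ) < Module.finrank ℝ E := by exact_mod_cast Module.finrank_pos
  have hm : Measurable fun q : E × ℝ =>
      gammaWeight (Module.finrank ℝ E) q.2 * heatKernel q.2 q.1 :=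
    ((measurable_gammaWeight _).comp measurable_snd).mul measurable_heatKernel
  rw [integrable_prod_iff' hm.aestronglyMeasurable]
  constructor
  · filter_upwards [ae_restrict_mem measurableSet_Ioi] with s hs
    exact (integrable_heatKernel hs).const_mul (gammaWeight (Module.finrank ℝ E) s)
  · refine (integrableOn_gammaWeight hd).congr ?_
    filter_upwards [ae_restrict_mem measurableSet_Ioi] with s hs
    have h1 : ∀ z : E, ‖gammaWeight (Module.finrank ℝ E) s * heatKernel s z‖ =
        gammaWeight (Module.finrank ℝ E) s * heatKernel s z := fun z =>
      Real.norm_of_nonneg (mul_nonneg (gammaWeight_nonneg hd (le_of_lt hs))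
        (heatKernel_nonneg (le_of_lt hs) z))
    simp_rw [h1]
    rw [integral_const_mul, integral_heatKernel hs, mul_one]

lemma integrable_besselKernel [Nontrivial E] : Integrable (besselKernel : E → ℝ) :=
  integrable_gammaWeight_mul_heatKernel.integral_prod_left

lemma integral_cexp_mul_besselKernel [Nontrivial E] (l : E) :
    ∫ z, Complex.exp ((⟪z, l⟫ : ℝ) * Complex.I) * (besselKernel z : ℂ) =
      ((1 + ‖l‖ ^ 2) ^ (-(Module.finrank ℝ E : ℝ)) : ℝ) := by
  have hd : (0 : ℝ) < Module.finrank ℝ E := by exact_mod_cast Module.finrank_pos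
  have e : ∀ z : E, Complex.exp ((⟪z, l⟫ : ℝ) * Complex.I) * (besselKernel z : ℂ) =
      ∫ s in Set.Ioi 0, Complex.exp ((⟪z, l⟫ : ℝ) * Complex.I) *
        ((gammaWeight (Module.finrank ℝ E) s * heatKernel s z : ℝ) : ℂ) := fun z => by
    rw [integral_const_mul, integral_complex_ofReal]; rfl
  simp_rw [e]
  have hi := integrable_gammaWeight_mul_heatKernel (E := E)
  rw [integral_integral_swap]
  · rw [← integral_gammaWeight_mul_exp hd (sq_nonneg ‖l‖), ← integral_complex_ofReal]
    refine setIntegral_congr_fun measurableSet_Ioi fun s hs => ?_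
    have e2 : ∀ z : E, Complex.exp ((⟪z, l⟫ : ℝ) * Complex.I) *
        ((gammaWeight (Module.finrank ℝ E) s * heatKernel s z : ℝ) : ℂ) =
        (gammaWeight (Module.finrank ℝ E) s : ℂ) *
          (Complex.exp ((⟪z, l⟫ : ℝ) * Complex.I) * (heatKernel s z : ℂ)) := fun z => by
      push_cast; ring
    simp_rw [e2]
    rw [integral_const_mul, integral_cexp_mul_heatKernel hs, Complex.ofReal_mul]
  · refine hi.norm.mono' ?_ (ae_of_all _ fun q => ?_)
    · have := (hi.ofReal (𝕜 := ℂ)).aestronglyMeasurable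
      refine AEStronglyMeasurable.mul (by fun_prop) this
    · simp only [Function.uncurry, norm_mul, norm_cexp_inner_mul_I, one_mul, Complex.norm_real,
        le_refl]

end Kernels

lemma integral_rpow_mul_exp_neg_div_Ioi {b r : ℝ} (hb : 0 < b) (hr : 0 < r) :
    ∫ s in Set.Ioi 0, s ^ (-b - 1) * Real.exp (-(r / s)) = (1 / r) ^ b * Real.Gamma b := by
  rw [← Real.integral_rpow_mul_exp_neg_mul_Ioi hb hr,
    ← integral_comp_rpow_Ioi (fun t => t ^ (b - 1) * Real.exp (-(r * t)))
      (show (-1 : ℝ) ≠ 0 by norm_num)]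
  refine setIntegral_congr_fun measurableSet_Ioi fun s (hs : 0 < s) => ?_
  simp only [smul_eq_mul, abs_neg, abs_one, one_mul]
  rw [← Real.rpow_mul hs.le, ← mul_assoc, ← Real.rpow_add hs, Real.rpow_neg_one, div_eq_mul_inv]
  ring_nf

/-- A product-measurable nonnegative function whose partial integrals form an integrable
function is integrable. -/
lemma integrable_prod_of_integral_eq {X Y : Type*} [MeasurableSpace X] [MeasurableSpace Y]
    {μ : Measure X} {ν : Measure Y} [SFinite μ] [SFinite ν] {φ : X × Y → ℝ} {ψ : X → ℝ}
    (hφ : AEStronglyMeasurable φ (μ.prod ν)) (h0 : ∀ᵐ x ∂μ, ∀ᵐ y ∂ν, 0 ≤ φ (x, y))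
    (hi : ∀ᵐ x ∂μ, Integrable (fun y => φ (x, y)) ν)
    (he : ∀ᵐ x ∂μ, ∫ y, φ (x, y) ∂ν = ψ x) (hψ : Integrable ψ μ) :
    Integrable φ (μ.prod ν) := by
  rw [integrable_prod_iff hφ]
  refine ⟨hi, hψ.congr ?_⟩
  filter_upwards [h0, he] with x h0x hx
  rw [← hx]
  refine integral_congr_ae ?_
  filter_upwards [h0x] with y hy
  exact (Real.norm_of_nonneg hy).symm

lemma integral_withDensity_ofReal {X : Type*} [MeasurableSpace X] {ν : Measure X} {φ : X → ℝ}
    (hφ : Measurable φ) (h0 : ∀ x, 0 ≤ φ x) (g : X → ℂ) :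
    ∫ x, g x ∂(ν.withDensity fun x => ENNReal.ofReal (φ x)) = ∫ x, (φ x : ℂ) * g x ∂ν := by
  rw [integral_withDensity_eq_integral_toReal_smul hφ.ennreal_ofReal
    (ae_of_all _ fun _ => ENNReal.ofReal_lt_top)]
  refine integral_congr_ae (ae_of_all _ fun x => ?_)
  simp only
  rw [ENNReal.toReal_ofReal (h0 x), Complex.real_smul]

section Riesz

variable {E : Type*} [NormedAddCommGroup E] [InnerProductSpace ℝ E]

/-- The transform of the Bessel kernel. -/
noncomputable def besselWeight (l : E) : ℝ := (1 + ‖l‖ ^ 2) ^ (-(Module.finrank ℝ E : ℝ))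

lemma besselWeight_pos (l : E) : 0 < besselWeight l := by
  unfold besselWeight; positivity

lemma continuous_besselWeight : Continuous (besselWeight : E → ℝ) := by
  unfold besselWeight
  exact Continuous.rpow_const (by fun_prop) fun l => Or.inl (by positivity)

lemma besselWeight_le_one (l : E) : besselWeight l ≤ 1 := by
  unfold besselWeight
  exact Real.rpow_le_one_of_one_le_of_nonpos (by nlinarith [sq_nonneg ‖l‖]) (by simp)

lemma integral_rpow_mul_heatKernel {a : ℝ} (had : a < Module.finrank ℝ E) {l : E}
    (hl : l ≠ 0) :
    ∫ s in Set.Ioi 0, s ^ (a / 2 - 1) * heatKernel s l =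
      Real.Gamma (((Module.finrank ℝ E : ℝ) - a) / 2) /
        (2 ^ a * Real.pi ^ ((Module.finrank ℝ E : ℝ) / 2)) * ‖l‖ ^ (a - Module.finrank ℝ E) := by
  have hl0 : 0 < ‖l‖ := norm_pos_iff.2 hl
  set d : ℝ := (Module.finrank ℝ E : ℝ)
  have e : ∀ s ∈ Set.Ioi (0 : ℝ), s ^ (a / 2 - 1) * heatKernel s l =
      (4 * Real.pi) ^ (-(d / 2)) *
        (s ^ (-((d - a) / 2) - 1) * Real.exp (-((‖l‖ ^ 2 / 4) / s))) := fun s (hs : 0 < s) => by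
    rw [heatKernel, Real.mul_rpow (by positivity) hs.le, show -((d - a) / 2) - 1 =
      (a / 2 - 1) + -(d / 2) by ring, Real.rpow_add hs, div_div]
    ring
  rw [setIntegral_congr_fun measurableSet_Ioi e, integral_const_mul,
    integral_rpow_mul_exp_neg_div_Ioi (by linarith) (by positivity)]
  have h1 : (1 / (‖l‖ ^ 2 / 4)) ^ ((d - a) / 2) = 2 ^ (d - a) * ‖l‖ ^ (a - d) := by
    rw [show 1 / (‖l‖ ^ 2 / 4) = (2 / ‖l‖) ^ (2 : ℝ) by rw [Real.rpow_two]; field_simp; norm_num,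
      ← Real.rpow_mul (by positivity), Real.div_rpow zero_le_two hl0.le, div_eq_mul_inv,
      ← Real.rpow_neg hl0.le]
    ring_nf
  have h2 : (4 * Real.pi) ^ (-(d / 2)) = 2 ^ (-d) * (Real.pi ^ (d / 2))⁻¹ := by
    rw [Real.mul_rpow (by norm_num) Real.pi_pos.le, ← Real.rpow_neg Real.pi_pos.le,
      show (4 : ℝ) = 2 ^ (2 : ℝ) by norm_num, ← Real.rpow_mul (by norm_num)]
    ring_nf
  have h3 : (2 : ℝ) ^ (d - a) = 2 ^ d * (2 ^ a)⁻¹ := by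
    rw [Real.rpow_sub two_pos, div_eq_mul_inv]
  have h4 : (2 : ℝ) ^ (-d) * 2 ^ d = 1 := by rw [← Real.rpow_add two_pos]; simp
  rw [h1, h2, h3]
  calc _ = ((2 : ℝ) ^ (-d) * 2 ^ d) * (Real.Gamma ((d - a) / 2) * (2 ^ a)⁻¹ *
        (Real.pi ^ (d / 2))⁻¹ * ‖l‖ ^ (a - d)) := by ring
    _ = _ := by rw [h4, one_mul, div_eq_mul_inv _ (_ * _), mul_inv]; ring

variable [FiniteDimensional ℝ E] [MeasurableSpace E] [BorelSpace E] [Nontrivial E]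

lemma integrable_besselWeight_mul_rpow {a : ℝ} (ha : 0 < a)
    (had : a < 2 * Module.finrank ℝ E) :
    Integrable fun l : E => besselWeight l * ‖l‖ ^ (a - Module.finrank ℝ E) := by
  have hd : 0 < Module.finrank ℝ E := Module.finrank_pos
  set d := Module.finrank ℝ E
  have h := integrable_fun_norm_addHaar (volume : Measure E)
    (f := fun y : ℝ => (1 + y ^ 2) ^ (-(d : ℝ)) * y ^ (a - d))
  refine h.2 ?_
  have e : ∀ y : ℝ, 0 < y → y ^ (d - 1) • ((1 + y ^ 2) ^ (-(d : ℝ)) * y ^ (a - d)) =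
      (1 + y ^ 2) ^ (-(d : ℝ)) * y ^ (a - 1) := fun y hy => by
    rw [smul_eq_mul, mul_left_comm, ← Real.rpow_natCast y (d - 1), ← Real.rpow_add hy,
      Nat.cast_sub (by omega)]
    congr 2; push_cast; ring
  refine IntegrableOn.congr_fun ?_ (fun y hy => (e y hy).symm) measurableSet_Ioi
  rw [← Set.Ioc_union_Ioi_eq_Ioi zero_le_one]
  have hm : Measurable fun y : ℝ => (1 + y ^ 2) ^ (-(d : ℝ)) * y ^ (a - 1) := by fun_prop
  refine IntegrableOn.union ?_ ?_
  · have h1 : IntegrableOn (fun y : ℝ => y ^ (a - 1)) (Set.Ioc 0 1) := by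
      rw [← intervalIntegrable_iff_integrableOn_Ioc_of_le zero_le_one]
      exact intervalIntegral.intervalIntegrable_rpow' (by linarith)
    refine h1.mono' hm.aestronglyMeasurable ?_
    filter_upwards [ae_restrict_mem measurableSet_Ioc] with y hy
    have hy0 := hy.1
    rw [Real.norm_of_nonneg (by positivity)]
    exact mul_le_of_le_one_left (by positivity)
      (Real.rpow_le_one_of_one_le_of_nonpos (by nlinarith [sq_nonneg y]) (by simp))
  · refine (integrableOn_Ioi_rpow_of_lt (a := a - 1 - 2 * d) (by linarith) one_pos).mono'
      hm.aestronglyMeasurable ?_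
    filter_upwards [ae_restrict_mem measurableSet_Ioi] with y hy
    have hy0 : (0 : ℝ) < y := zero_lt_one.trans hy
    rw [Real.norm_of_nonneg (by positivity), show a - 1 - 2 * (d : ℝ) = 2 * -(d : ℝ) + (a - 1) by
      ring, Real.rpow_add hy0, Real.rpow_mul hy0.le, Real.rpow_two]
    refine mul_le_mul_of_nonneg_right ?_ (by positivity)
    exact Real.rpow_le_rpow_of_nonpos (by positivity) (by linarith) (by simp)

lemma integrable_besselKernel_mul_rpow {q : ℝ} (hq0 : 0 ≤ q) (hq : q < Module.finrank ℝ E)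
    (u : E) : Integrable fun z : E => besselKernel z * ‖z + u‖ ^ (-q) := by
  obtain ⟨K, hK⟩ := exists_besselKernel_le (E := E)
  have hK0 : 0 ≤ K := (besselKernel_nonneg (0 : E)).trans (hK 0)
  have h1 := (integrable_besselWeight_mul_rpow (E := E)
    (a := Module.finrank ℝ E - q) (by linarith) (by linarith)).comp_add_right u
  refine ((h1.const_mul (K * 2 ^ (Module.finrank ℝ E : ℝ))).fun_add
    (integrable_besselKernel (E := E))).mono' ?_ (ae_of_all _ fun z => ?_)
  · exact (integrable_besselKernel (E := E)).aestronglyMeasurable.mul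
      (Measurable.aestronglyMeasurable (by fun_prop))
  · have hk0 := besselKernel_nonneg z
    rw [Real.norm_of_nonneg (by positivity), sub_sub_cancel_left]
    have hw0 := besselWeight_pos (z + u)
    rcases le_or_gt ‖z + u‖ 1 with h | h
    · have hw : 1 ≤ 2 ^ (Module.finrank ℝ E : ℝ) * besselWeight (z + u) := by
        rw [besselWeight, Real.rpow_neg (by positivity), ← div_eq_mul_inv,
          one_le_div (by positivity)]
        exact Real.rpow_le_rpow (by positivity) (by nlinarith [norm_nonneg (z + u)]) (by simp)
      calc besselKernel z * ‖z + u‖ ^ (-q) ≤ K * ‖z + u‖ ^ (-q) :=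
            mul_le_mul_of_nonneg_right (hK z) (by positivity)
        _ ≤ K * ‖z + u‖ ^ (-q) * (2 ^ (Module.finrank ℝ E : ℝ) * besselWeight (z + u)) :=
            le_mul_of_one_le_right (by positivity) hw
        _ = K * 2 ^ (Module.finrank ℝ E : ℝ) * (besselWeight (z + u) * ‖z + u‖ ^ (-q)) := by ring
        _ ≤ _ := le_add_of_nonneg_right hk0
    · have h2 : ‖z + u‖ ^ (-q) ≤ 1 := Real.rpow_le_one_of_one_le_of_nonpos h.le (by linarith)
      calc besselKernel z * ‖z + u‖ ^ (-q) ≤ besselKernel z :=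
            mul_le_of_le_one_right hk0 h2
        _ ≤ _ := le_add_of_nonneg_left (by positivity)

/-- The transform of the Bessel kernel weighted by a Riesz kernel. -/
lemma integral_besselKernel_mul_rpow {a : ℝ} (ha : 0 < a) (had : a < Module.finrank ℝ E)
    (u : E) :
    ((∫ z : E, besselKernel z * ‖z + u‖ ^ (-a) : ℝ) : ℂ) =
      (tauberK (Module.finrank ℝ E) a : ℂ) *
        ∫ l : E, Complex.exp ((⟪l, u⟫ : ℝ) * Complex.I) *
          ((besselWeight l * ‖l‖ ^ (a - Module.finrank ℝ E) : ℝ) : ℂ) := by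
  have hG : 0 < Real.Gamma (a / 2) := Real.Gamma_pos_of_pos (half_pos ha)
  have hd0 : (0 : ℝ) < Module.finrank ℝ E := ha.trans had
  have hdiff (s : ℝ) (hs : 0 < s) :
      ∫ z : E, (besselKernel z : ℂ) * ((Real.exp (-(s * ‖z + u‖ ^ 2)) : ℝ) : ℂ) =
        ∫ l : E, Complex.exp ((⟪l, u⟫ : ℝ) * Complex.I) *
          ((besselWeight l * heatKernel s l : ℝ) : ℂ) := by
    have : IsFiniteMeasure ((volume : Measure E).withDensity
        fun l => ENNReal.ofReal (heatKernel s l)) :=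
      isFiniteMeasure_withDensity_ofReal (integrable_heatKernel hs).2
    have hw (g : E → ℂ) : ∫ l, g l ∂((volume : Measure E).withDensity
        fun l => ENNReal.ofReal (heatKernel s l)) = ∫ l, g l * (heatKernel s l : ℂ) := by
      rw [integral_withDensity_ofReal (φ := heatKernel s) (measurable_heatKernel.comp
        (measurable_id.prodMk measurable_const)) (heatKernel_nonneg hs.le)]
      simp_rw [mul_comm]
    have h1 := integral_transform_eq_integral_charFun
      (ν := (volume : Measure E).withDensity fun l => ENNReal.ofReal (heatKernel s l))
      (integrable_besselKernel (E := E)) u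
    have hc (v : E) : charFun ((volume : Measure E).withDensity
        fun l => ENNReal.ofReal (heatKernel s l)) v =
        ((Real.exp (-(s * ‖v‖ ^ 2)) : ℝ) : ℂ) := by
      rw [charFun_apply, hw, integral_cexp_mul_heatKernel hs]
    simp_rw [hc, integral_cexp_mul_besselKernel] at h1
    rw [← h1, hw]
    refine integral_congr_ae (ae_of_all _ fun l => ?_)
    simp only [besselWeight]
    push_cast
    ring
  have hne : ∀ᵐ z : E, z ≠ 0 := by simp [ae_iff, measure_singleton]
  have hne' : ∀ᵐ z : E, z + u ≠ 0 := by
    have : ∀ z : E, ¬ (z + u ≠ 0) ↔ z = -u := fun z => by rw [not_not, eq_neg_iff_add_eq_zero]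
    simp [ae_iff, this, measure_singleton]
  have hspos : ∀ᵐ s ∂((volume : Measure ℝ).restrict (Set.Ioi 0)), 0 < s :=
    ae_restrict_mem measurableSet_Ioi
  have hA (z : E) (hz : z + u ≠ 0) :
      ∫ s in Set.Ioi 0, besselKernel z * (s ^ (a / 2 - 1) * Real.exp (-(‖z + u‖ ^ 2 * s))) =
        Real.Gamma (a / 2) * (besselKernel z * ‖z + u‖ ^ (-a)) := by
    have h0 : 0 < ‖z + u‖ := norm_pos_iff.2 hz
    rw [integral_const_mul, Real.integral_rpow_mul_exp_neg_mul_Ioi (half_pos ha) (by positivity),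
      one_div, Real.inv_rpow (by positivity), ← Real.rpow_two, ← Real.rpow_mul h0.le,
      Real.rpow_neg h0.le]
    ring_nf
  have hB (l : E) (hl : l ≠ 0) :
      ∫ s in Set.Ioi 0, besselWeight l * (s ^ (a / 2 - 1) * heatKernel s l) =
        Real.Gamma (a / 2) * (tauberK (Module.finrank ℝ E) a *
          (besselWeight l * ‖l‖ ^ (a - Module.finrank ℝ E))) := by
    rw [integral_const_mul, integral_rpow_mul_heatKernel had hl, tauberK]
    field_simp
  have hA1 : Integrable (fun q : E × ℝ => besselKernel q.1 *
      (q.2 ^ (a / 2 - 1) * Real.exp (-(‖q.1 + u‖ ^ 2 * q.2))))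
      (volume.prod (volume.restrict (Set.Ioi 0))) := by
    refine integrable_prod_of_integral_eq ?_ ?_ ?_ ?_
      ((integrable_besselKernel_mul_rpow ha.le had u).const_mul (Real.Gamma (a / 2)))
    · exact (integrable_besselKernel (E := E)).aestronglyMeasurable.comp_fst.mul
        (Measurable.aestronglyMeasurable (by fun_prop))
    · refine ae_of_all _ fun z => ?_
      filter_upwards [hspos] with s hs
      have := besselKernel_nonneg z
      positivity
    · filter_upwards [hne'] with z hz
      have h0 : 0 < ‖z + u‖ := norm_pos_iff.2 hz
      refine Integrable.const_mul (Integrable.of_integral_ne_zero ?_) _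
      rw [Real.integral_rpow_mul_exp_neg_mul_Ioi (half_pos ha) (by positivity)]
      positivity
    · filter_upwards [hne'] with z hz using hA z hz
  have hB1 : Integrable (fun q : E × ℝ => besselWeight q.1 *
      (q.2 ^ (a / 2 - 1) * heatKernel q.2 q.1))
      (volume.prod (volume.restrict (Set.Ioi 0))) := by
    refine integrable_prod_of_integral_eq ?_ ?_ ?_ ?_
      (((integrable_besselWeight_mul_rpow ha (by linarith)).const_mul
        (tauberK (Module.finrank ℝ E) a)).const_mul (Real.Gamma (a / 2)))
    · exact ((continuous_besselWeight.measurable.comp measurable_fst).mul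
        (Measurable.mul (by fun_prop) measurable_heatKernel)).aestronglyMeasurable
    · refine ae_of_all _ fun l => ?_
      filter_upwards [hspos] with s hs
      have := besselWeight_pos l
      have := heatKernel_nonneg hs.le l
      positivity
    · filter_upwards [hne] with l hl
      have h0 : 0 < ‖l‖ := norm_pos_iff.2 hl
      have h1 : 0 < Real.Gamma (((Module.finrank ℝ E : ℝ) - a) / 2) :=
        Real.Gamma_pos_of_pos (by linarith)
      refine Integrable.const_mul (Integrable.of_integral_ne_zero ?_) _
      rw [integral_rpow_mul_heatKernel had hl]
      positivity
    · filter_upwards [hne] with l hl using hB l hl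
  have hB2 : Integrable (fun q : E × ℝ => Complex.exp ((⟪q.1, u⟫ : ℝ) * Complex.I) *
      ((besselWeight q.1 * (q.2 ^ (a / 2 - 1) * heatKernel q.2 q.1) : ℝ) : ℂ))
      (volume.prod (volume.restrict (Set.Ioi 0))) := by
    refine hB1.norm.mono' (AEStronglyMeasurable.mul (by fun_prop)
      (hB1.ofReal (𝕜 := ℂ)).aestronglyMeasurable) (ae_of_all _ fun q => ?_)
    rw [norm_mul, norm_cexp_inner_mul_I, one_mul, Complex.norm_real]
  have hG' : (Real.Gamma (a / 2) : ℂ) ≠ 0 := by exact_mod_cast hG.ne'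
  refine mul_left_cancel₀ hG' ?_
  calc (Real.Gamma (a / 2) : ℂ) * ((∫ z : E, besselKernel z * ‖z + u‖ ^ (-a) : ℝ) : ℂ)
      = ((∫ z : E, ∫ s in Set.Ioi 0, besselKernel z *
          (s ^ (a / 2 - 1) * Real.exp (-(‖z + u‖ ^ 2 * s))) : ℝ) : ℂ) := by
        rw [← Complex.ofReal_mul, ← integral_const_mul]
        congr 1
        refine integral_congr_ae ?_
        filter_upwards [hne'] with z hz
        exact (hA z hz).symm
    _ = ((∫ s in Set.Ioi 0, ∫ z : E, besselKernel z *
          (s ^ (a / 2 - 1) * Real.exp (-(‖z + u‖ ^ 2 * s))) : ℝ) : ℂ) := by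
        rw [integral_integral_swap hA1]
    _ = ∫ s in Set.Ioi 0, ∫ l : E, Complex.exp ((⟪l, u⟫ : ℝ) * Complex.I) *
          ((besselWeight l * (s ^ (a / 2 - 1) * heatKernel s l) : ℝ) : ℂ) := by
        rw [← integral_complex_ofReal]
        refine setIntegral_congr_fun measurableSet_Ioi fun s (hs : 0 < s) => ?_
        have e1 : ∀ l : E, Complex.exp ((⟪l, u⟫ : ℝ) * Complex.I) *
            ((besselWeight l * (s ^ (a / 2 - 1) * heatKernel s l) : ℝ) : ℂ) =
            ((s ^ (a / 2 - 1) : ℝ) : ℂ) * (Complex.exp ((⟪l, u⟫ : ℝ) * Complex.I) *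
              ((besselWeight l * heatKernel s l : ℝ) : ℂ)) := fun l => by push_cast; ring
        have e2 : ∀ z : E, ((besselKernel z *
            (s ^ (a / 2 - 1) * Real.exp (-(‖z + u‖ ^ 2 * s))) : ℝ) : ℂ) =
            ((s ^ (a / 2 - 1) : ℝ) : ℂ) * ((besselKernel z : ℂ) *
              ((Real.exp (-(s * ‖z + u‖ ^ 2)) : ℝ) : ℂ)) := fun z => by
          rw [mul_comm s]; push_cast; ring
        rw [← integral_complex_ofReal]
        simp_rw [e1, e2]
        rw [integral_const_mul, integral_const_mul, hdiff s hs]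
    _ = ∫ l : E, ∫ s in Set.Ioi 0, Complex.exp ((⟪l, u⟫ : ℝ) * Complex.I) *
          ((besselWeight l * (s ^ (a / 2 - 1) * heatKernel s l) : ℝ) : ℂ) := by
        exact (integral_integral_swap hB2).symm
    _ = _ := by
        rw [← integral_const_mul, ← integral_const_mul]
        refine integral_congr_ae ?_
        filter_upwards [hne] with l hl
        rw [integral_const_mul, integral_complex_ofReal, hB l hl]
        push_cast
        ring

end Riesz

/-- Lévy's continuity theorem for finite measures with a nonzero limit. -/
lemma tendsto_integral_of_tendsto_charFun {E : Type*} [NormedAddCommGroup E]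
    [InnerProductSpace ℝ E] [FiniteDimensional ℝ E] [MeasurableSpace E] [BorelSpace E]
    {ν : ℕ → Measure E} [∀ k, IsFiniteMeasure (ν k)] {ρ : Measure E} [IsFiniteMeasure ρ]
    (hρ : ρ ≠ 0) (h : ∀ u, Tendsto (fun k => charFun (ν k) u) atTop (𝓝 (charFun ρ u)))
    (g : BoundedContinuousFunction E ℂ) :
    Tendsto (fun k => ∫ l, g l ∂(ν k)) atTop (𝓝 (∫ l, g l ∂ρ)) := by
  let fν : ℕ → FiniteMeasure E := fun k => ⟨ν k, inferInstance⟩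
  let fρ : FiniteMeasure E := ⟨ρ, inferInstance⟩
  have hfρ : fρ ≠ 0 := fun h0 => hρ (congrArg Subtype.val h0)
  have hmass : Tendsto (fun k => (ν k).real Set.univ) atTop (𝓝 (ρ.real Set.univ)) := by
    have h0 := h 0
    simp only [charFun_zero] at h0
    exact_mod_cast (Complex.continuous_re.tendsto _).comp h0
  have hρpos : ρ.real Set.univ ≠ 0 := by
    rwa [Ne, measureReal_eq_zero_iff, Measure.measure_univ_eq_zero]
  have hne : ∀ᶠ k in atTop, fν k ≠ 0 := by
    filter_upwards [hmass.eventually_ne hρpos] with k hk h0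
    have : ν k = 0 := congrArg Subtype.val h0
    simp [this] at hk
  have key (f : E → ℂ) (η : FiniteMeasure E) (hη : η ≠ 0) :
      ∫ l, f l ∂(η.normalize : Measure E) =
        ((((η : Measure E).real Set.univ)⁻¹ : ℝ) : ℂ) * ∫ l, f l ∂(η : Measure E) := by
    rw [← FiniteMeasure.average_eq_integral_normalize η hη, average_eq, Complex.real_smul]
  have hinv : Tendsto (fun k => ((((ν k).real Set.univ)⁻¹ : ℝ) : ℂ)) atTop
      (𝓝 (((ρ.real Set.univ)⁻¹ : ℝ) : ℂ)) :=
    (Complex.continuous_ofReal.tendsto _).comp (hmass.inv₀ hρpos)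
  have hT : Tendsto (fun k => (fν k).normalize) atTop (𝓝 fρ.normalize) := by
    refine ProbabilityMeasure.tendsto_of_tendsto_charFun fun t => ?_
    simp only [charFun_apply]
    rw [key _ fρ hfρ]
    refine (hinv.mul (h t)).congr' ?_
    filter_upwards [hne] with k hk
    rw [key _ (fν k) hk, charFun_apply]
    rfl
  have hg := (ProbabilityMeasure.tendsto_iff_forall_integral_rclike_tendsto ℂ).1 hT g
  rw [key _ fρ hfρ] at hg
  change Tendsto _ _ (𝓝 ((((ρ.real Set.univ)⁻¹ : ℝ) : ℂ) * ∫ l, g l ∂ρ)) at hg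
  have hm : Tendsto (fun k => (((ν k).real Set.univ : ℝ) : ℂ)) atTop
      (𝓝 ((ρ.real Set.univ : ℝ) : ℂ)) := (Complex.continuous_ofReal.tendsto _).comp hmass
  have h2 := hm.mul hg
  rw [← mul_assoc, ← Complex.ofReal_mul, mul_inv_cancel₀ hρpos, Complex.ofReal_one,
    one_mul] at h2
  refine h2.congr' ?_
  filter_upwards [hne, hmass.eventually_ne hρpos] with k hk hk0
  rw [key _ (fν k) hk, ← mul_assoc, ← Complex.ofReal_mul]
  change (((ν k).real Set.univ * ((ν k).real Set.univ)⁻¹ : ℝ) : ℂ) * _ = _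
  rw [mul_inv_cancel₀ hk0, Complex.ofReal_one, one_mul]
  rfl

lemma exists_one_add_sq_rpow_mul_exp_neg_le {A α : ℝ} (hA : 0 < A) (hα : 0 < α) {N : ℝ}
    (hN : 0 ≤ N) :
    ∃ C, ∀ r, 0 ≤ r → (1 + r ^ 2) ^ N * Real.exp (-(A * r ^ α)) ≤ C := by
  obtain ⟨M, hM⟩ := exists_nat_ge (2 * N / α)
  refine ⟨2 ^ N * (1 + M.factorial / A ^ M), fun r hr => ?_⟩
  have hy : 0 ≤ r ^ α := by positivity
  rcases le_or_gt r 1 with h | h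
  · have h1 : (1 + r ^ 2) ^ N ≤ 2 ^ N := Real.rpow_le_rpow (by positivity) (by nlinarith) hN
    have h2 : Real.exp (-(A * r ^ α)) ≤ 1 := Real.exp_le_one_iff.2 (by
      rw [neg_nonpos]; positivity)
    refine mul_le_mul h1 (h2.trans ?_) (Real.exp_pos _).le (by positivity)
    exact le_add_of_nonneg_right (by positivity)
  · have h1 : (1 + r ^ 2) ^ N ≤ 2 ^ N * (r ^ α) ^ M := by
      calc (1 + r ^ 2) ^ N ≤ (2 * r ^ 2) ^ N :=
            Real.rpow_le_rpow (by positivity) (by nlinarith) hN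
        _ = 2 ^ N * r ^ (2 * N) := by
            rw [Real.mul_rpow zero_le_two (by positivity), ← Real.rpow_two, ← Real.rpow_mul hr]
        _ ≤ 2 ^ N * r ^ (α * M) := by
            refine mul_le_mul_of_nonneg_left ?_ (by positivity)
            refine Real.rpow_le_rpow_of_exponent_le h.le ?_
            rwa [div_le_iff₀' hα] at hM
        _ = _ := by rw [Real.rpow_mul hr, Real.rpow_natCast]
    have h2 := Real.pow_div_factorial_le_exp _ (mul_nonneg hA.le hy) M
    rw [div_le_iff₀ (by positivity), mul_pow] at h2
    have h3 : (r ^ α) ^ M * Real.exp (-(A * r ^ α)) ≤ M.factorial / A ^ M := by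
      rw [Real.exp_neg, ← div_eq_mul_inv, div_le_div_iff₀ (Real.exp_pos _) (by positivity)]
      linarith
    calc _ ≤ 2 ^ N * (r ^ α) ^ M * Real.exp (-(A * r ^ α)) :=
          mul_le_mul_of_nonneg_right h1 (Real.exp_pos _).le
      _ = 2 ^ N * ((r ^ α) ^ M * Real.exp (-(A * r ^ α))) := by ring
      _ ≤ 2 ^ N * (1 + M.factorial / A ^ M) :=
          mul_le_mul_of_nonneg_left (by linarith) (by positivity)

lemma one_add_mul_pow_le {s y : ℝ} (hs0 : 0 ≤ s) (hs1 : s ≤ 1) (hy : 0 ≤ y) (k : ℕ) :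
    (1 + s * y) ^ k ≤ 1 + s * ((1 + y) ^ k - 1) := by
  induction k with
  | zero => simp
  | succ k ih =>
    have hP : 1 ≤ (1 + y) ^ k := one_le_pow₀ (by linarith)
    have h1 := mul_le_mul_of_nonneg_right ih (show 0 ≤ 1 + s * y by positivity)
    have h2 : s * s * (y * ((1 + y) ^ k - 1)) ≤ s * (y * ((1 + y) ^ k - 1)) :=
      mul_le_mul_of_nonneg_right (by nlinarith) (mul_nonneg hy (by linarith))
    rw [pow_succ, pow_succ]
    nlinarith

lemma abs_exp_neg_mul_sub_exp_neg_le {X b : ℝ} (hX : 0 ≤ X) (hb : 1 ≤ b) :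
    |Real.exp (-(X * b)) - Real.exp (-X)| ≤ 2 * Real.exp (-(X / 2)) * (b - 1) := by
  have h1 : Real.exp (-(X * b)) = Real.exp (-X) * Real.exp (-(X * (b - 1))) := by
    rw [← Real.exp_add]; ring_nf
  have h2 : Real.exp (-(X * (b - 1))) ≤ 1 := Real.exp_le_one_iff.2 (by nlinarith)
  have h3 : 1 - X * (b - 1) ≤ Real.exp (-(X * (b - 1))) := by
    linarith [Real.add_one_le_exp (-(X * (b - 1)))]
  have h4 : X ≤ 2 * Real.exp (X / 2) := by linarith [Real.add_one_le_exp (X / 2)]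
  have h5 : Real.exp (-X) * X ≤ 2 * Real.exp (-(X / 2)) := by
    calc Real.exp (-X) * X ≤ Real.exp (-X) * (2 * Real.exp (X / 2)) :=
          mul_le_mul_of_nonneg_left h4 (Real.exp_pos _).le
      _ = 2 * (Real.exp (-X) * Real.exp (X / 2)) := by ring
      _ = _ := by rw [← Real.exp_add]; ring_nf
  rw [h1, abs_sub_comm, abs_of_nonneg (by nlinarith [Real.exp_pos (-X)])]
  calc Real.exp (-X) - Real.exp (-X) * Real.exp (-(X * (b - 1)))
      = Real.exp (-X) * (1 - Real.exp (-(X * (b - 1)))) := by ring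
    _ ≤ Real.exp (-X) * (X * (b - 1)) :=
        mul_le_mul_of_nonneg_left (by linarith) (Real.exp_pos _).le
    _ = Real.exp (-X) * X * (b - 1) := by ring
    _ ≤ _ := mul_le_mul_of_nonneg_right h5 (by linarith)

/-- The symbol with a vanishing Bessel factor converges at a quadratic rate, uniformly against
any polynomial weight. -/
lemma exists_bound_exp_symbol_sub {A α γ : ℝ} (hA : 0 < A) (hα : 0 < α) (hγ : 0 ≤ γ) {N : ℝ}
    (hN : 0 ≤ N) :
    ∃ C, 0 ≤ C ∧ ∀ T, 1 ≤ T → ∀ r, 0 ≤ r →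
      |Real.exp (-(A * r ^ α * (1 + (T⁻¹ * r) ^ 2) ^ (γ / 2))) - Real.exp (-(A * r ^ α))| ≤
        C * T⁻¹ ^ 2 * (1 + r ^ 2) ^ (-N) := by
  obtain ⟨k, hk⟩ := exists_nat_ge (γ / 2)
  obtain ⟨C, hC⟩ := exists_one_add_sq_rpow_mul_exp_neg_le (half_pos hA) hα
    (add_nonneg hN k.cast_nonneg)
  have hC0 : 0 ≤ C := le_trans (by positivity) (hC 0 le_rfl)
  refine ⟨2 * C, by positivity, fun T hT r hr => ?_⟩
  have hT0 : 0 < T := by linarith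
  have hT1 : T⁻¹ ≤ 1 := inv_le_one_of_one_le₀ hT
  have hs0 : 0 ≤ T⁻¹ ^ 2 := by positivity
  have hs1 : T⁻¹ ^ 2 ≤ 1 := pow_le_one₀ (by positivity) hT1
  have hbase : 1 ≤ 1 + (T⁻¹ * r) ^ 2 := by nlinarith [sq_nonneg (T⁻¹ * r)]
  have hb : 1 ≤ (1 + (T⁻¹ * r) ^ 2) ^ (γ / 2) := Real.one_le_rpow hbase (by positivity)
  have hb2 : (1 + (T⁻¹ * r) ^ 2) ^ (γ / 2) - 1 ≤ T⁻¹ ^ 2 * (1 + r ^ 2) ^ k := by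
    have h1 : (1 + (T⁻¹ * r) ^ 2) ^ (γ / 2) ≤ (1 + (T⁻¹ * r) ^ 2) ^ k := by
      rw [← Real.rpow_natCast _ k]
      exact Real.rpow_le_rpow_of_exponent_le hbase hk
    have h2 := one_add_mul_pow_le hs0 hs1 (sq_nonneg r) k
    rw [mul_pow] at h1 hb ⊢
    nlinarith
  refine (abs_exp_neg_mul_sub_exp_neg_le (by positivity) hb).trans ?_
  have h3 := hC r hr
  rw [Real.rpow_add (by positivity), Real.rpow_natCast, mul_comm _ ((1 + r ^ 2) ^ k),
    mul_assoc] at h3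
  have hN1 : (1 + r ^ 2) ^ (-N) * (1 + r ^ 2) ^ N = 1 := by
    rw [← Real.rpow_add (by positivity)]; simp
  calc 2 * Real.exp (-(A * r ^ α / 2)) * ((1 + (T⁻¹ * r) ^ 2) ^ (γ / 2) - 1)
      ≤ 2 * Real.exp (-(A * r ^ α / 2)) * (T⁻¹ ^ 2 * (1 + r ^ 2) ^ k) :=
        mul_le_mul_of_nonneg_left hb2 (by positivity)
    _ = 2 * T⁻¹ ^ 2 * ((1 + r ^ 2) ^ (-N) * (1 + r ^ 2) ^ N) *
          ((1 + r ^ 2) ^ k * Real.exp (-(A / 2 * r ^ α))) := by rw [hN1]; ring_nf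
    _ = 2 * T⁻¹ ^ 2 * (1 + r ^ 2) ^ (-N) *
          ((1 + r ^ 2) ^ k * ((1 + r ^ 2) ^ N * Real.exp (-(A / 2 * r ^ α)))) := by ring
    _ ≤ 2 * T⁻¹ ^ 2 * (1 + r ^ 2) ^ (-N) * C :=
        mul_le_mul_of_nonneg_left h3 (by positivity)
    _ = _ := by ring

lemma tauberK_pos {d : ℕ} {a : ℝ} (ha : 0 < a) (had : a < d) : 0 < tauberK d a := by
  have h1 : 0 < Real.Gamma (((d : ℝ) - a) / 2) := Real.Gamma_pos_of_pos (by linarith)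
  have h2 : 0 < Real.Gamma (a / 2) := Real.Gamma_pos_of_pos (half_pos ha)
  unfold tauberK; positivity

section Rescaled

variable {E : Type*} [NormedAddCommGroup E] [InnerProductSpace ℝ E]
  [MeasurableSpace E] [BorelSpace E]

/-- The image of a finite measure under a dilation, weighted by the transform of the Bessel
kernel and a constant. -/
noncomputable def rescaledMeasure (F : Measure E) (D T : ℝ) : Measure E :=
  (F.map (T • ·)).withDensity fun l => ENNReal.ofReal (D⁻¹ * besselWeight l)

lemma integral_rescaledMeasure {F : Measure E} {D : ℝ} (hD : 0 < D) (T : ℝ) {g : E → ℂ}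
    (hg : Continuous g) : ∫ l, g l ∂(rescaledMeasure F D T) =
      ((D⁻¹ : ℝ) : ℂ) * ∫ l, (besselWeight (T • l) : ℂ) * g (T • l) ∂F := by
  have hc : Continuous fun l : E => ((D⁻¹ * besselWeight l : ℝ) : ℂ) * g l :=
    (Complex.continuous_ofReal.comp (continuous_besselWeight.const_mul _)).mul hg
  rw [rescaledMeasure, integral_withDensity_ofReal
    (continuous_besselWeight.measurable.const_mul _)
    (fun l => by have := besselWeight_pos l; positivity), integral_map (by fun_prop)
    hc.aestronglyMeasurable, ← integral_const_mul]
  simp_rw [Complex.ofReal_mul, mul_assoc]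

variable [FiniteDimensional ℝ E]

/-- The limiting spectral measure, weighted by the transform of the Bessel kernel. -/
noncomputable def rieszMeasure (E : Type*) [NormedAddCommGroup E] [InnerProductSpace ℝ E]
    [FiniteDimensional ℝ E] [MeasurableSpace E] [BorelSpace E] (c a : ℝ) : Measure E :=
  volume.withDensity fun l => ENNReal.ofReal
    (c * tauberK (Module.finrank ℝ E) a * (besselWeight l * ‖l‖ ^ (a - Module.finrank ℝ E)))

lemma integral_rieszMeasure {c a : ℝ} (hc : 0 < c) (ha : 0 < a) (had : a < Module.finrank ℝ E)
    (g : E → ℂ) :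
    ∫ l, g l ∂(rieszMeasure E c a) = ((c * tauberK (Module.finrank ℝ E) a : ℝ) : ℂ) *
      ∫ l, g l * ((besselWeight l * ‖l‖ ^ (a - Module.finrank ℝ E) : ℝ) : ℂ) := by
  have hK := tauberK_pos ha had
  have hm : Measurable fun l : E =>
      c * tauberK (Module.finrank ℝ E) a * (besselWeight l * ‖l‖ ^ (a - Module.finrank ℝ E)) :=
    measurable_const.mul (continuous_besselWeight.measurable.mul (by fun_prop))
  rw [rieszMeasure, integral_withDensity_ofReal hm
    (fun l => by have := besselWeight_pos l; positivity), ← integral_const_mul]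
  refine integral_congr_ae (ae_of_all _ fun l => ?_)
  simp only
  push_cast
  ring

variable [Nontrivial E]

lemma isFiniteMeasure_rieszMeasure {a : ℝ} (c : ℝ) (ha : 0 < a) (had : a < Module.finrank ℝ E) :
    IsFiniteMeasure (rieszMeasure E c a) :=
  isFiniteMeasure_withDensity_ofReal
    ((integrable_besselWeight_mul_rpow ha (by linarith)).const_mul _).2

lemma rieszMeasure_ne_zero {c a : ℝ} (hc : 0 < c) (ha : 0 < a) (had : a < Module.finrank ℝ E) :
    rieszMeasure E c a ≠ 0 := by
  intro h
  have hm : Measurable fun l : E =>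
      c * tauberK (Module.finrank ℝ E) a * (besselWeight l * ‖l‖ ^ (a - Module.finrank ℝ E)) :=
    measurable_const.mul (continuous_besselWeight.measurable.mul (by fun_prop))
  rw [rieszMeasure, withDensity_eq_zero_iff hm.ennreal_ofReal.aemeasurable] at h
  have hne : ∀ᵐ z : E, z ≠ 0 := by simp [ae_iff, measure_singleton]
  have : ∀ᵐ z : E, False := by
    filter_upwards [h, hne] with z hz hz0
    have h1 := norm_pos_iff.2 hz0
    have h2 := tauberK_pos ha had
    have h3 := besselWeight_pos z
    have : 0 < c * tauberK (Module.finrank ℝ E) a *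
      (besselWeight z * ‖z‖ ^ (a - Module.finrank ℝ E)) := by positivity
    simp only [Pi.zero_apply, ENNReal.ofReal_eq_zero] at hz
    linarith
  simp [ae_iff] at this

lemma charFun_rieszMeasure {c a : ℝ} (hc : 0 < c) (ha : 0 < a) (had : a < Module.finrank ℝ E)
    (u : E) : charFun (rieszMeasure E c a) u =
      ((∫ z : E, besselKernel z * (c * ‖z + u‖ ^ (-a)) : ℝ) : ℂ) := by
  rw [charFun_apply, integral_rieszMeasure hc ha had, Complex.ofReal_mul, mul_assoc,
    ← integral_besselKernel_mul_rpow ha had, ← Complex.ofReal_mul, ← integral_const_mul]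
  simp_rw [mul_left_comm c]

variable {F : Measure E} [IsFiniteMeasure F]

instance isFiniteMeasure_rescaledMeasure (D T : ℝ) :
    IsFiniteMeasure (rescaledMeasure F D T) := by
  refine isFiniteMeasure_withDensity_ofReal (Integrable.const_mul ?_ _).2
  refine Integrable.of_bound continuous_besselWeight.aestronglyMeasurable 1
    (ae_of_all _ fun l => ?_)
  rw [Real.norm_of_nonneg (besselWeight_pos l).le]
  exact besselWeight_le_one l

lemma charFun_rescaledMeasure {D : ℝ} (hD : 0 < D) (T : ℝ) {B : E → ℝ}
    (hF : ∀ z, charFun F z = (B z : ℂ)) (u : E) :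
    charFun (rescaledMeasure F D T) u =
      ((∫ z : E, besselKernel z * (B (T • (z + u)) / D) : ℝ) : ℂ) := by
  rw [charFun_apply, integral_rescaledMeasure hD T (by fun_prop)]
  have h := integral_transform_eq_integral_charFun (ν := F.map (T • ·))
    (integrable_besselKernel (E := E)) u
  simp_rw [integral_cexp_mul_besselKernel, charFun_map_smul, hF] at h
  rw [integral_map (by fun_prop)] at h
  · have e : ∀ z : E, besselKernel z * (B (T • (z + u)) / D) =
        D⁻¹ * (besselKernel z * B (T • (z + u))) := fun z => by ring
    simp_rw [e]
    rw [integral_const_mul, Complex.ofReal_mul, ← integral_complex_ofReal]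
    simp_rw [Complex.ofReal_mul]
    rw [← h]
    simp_rw [besselWeight, mul_comm]
  · have hc : Continuous fun l : E => ((besselWeight l : ℝ) : ℂ) :=
      Complex.continuous_ofReal.comp continuous_besselWeight
    exact (Continuous.mul (by fun_prop) hc).aestronglyMeasurable

/-- Weak convergence of the rescaled spectral measures. -/
lemma tendsto_integral_rescaledMeasure {B : E → ℝ} (hF : ∀ z, charFun F z = (B z : ℂ))
    {D : ℝ → ℝ} (hD : ∀ T, 0 < T → 0 < D T) {K T₀ q : ℝ} (hq0 : 0 ≤ q)
    (hq : q < Module.finrank ℝ E)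
    (hbd : ∀ T, T₀ ≤ T → ∀ z : E, z ≠ 0 → |B (T • z) / D T| ≤ K * (‖z‖ ^ (-q) + 1))
    {c a : ℝ} (hc : 0 < c) (ha : 0 < a) (had : a < Module.finrank ℝ E)
    (hlim : ∀ z : E, z ≠ 0 →
      Tendsto (fun T => B (T • z) / D T) atTop (𝓝 (c * ‖z‖ ^ (-a))))
    (g : BoundedContinuousFunction E ℂ) :
    Tendsto (fun T => ∫ l, g l ∂(rescaledMeasure F (D T) T)) atTop
      (𝓝 (∫ l, g l ∂(rieszMeasure E c a))) := by
  have hBm : Measurable B := by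
    have : B = fun z => (charFun F z).re := by ext z; rw [hF, Complex.ofReal_re]
    rw [this]
    exact Complex.measurable_re.comp continuous_charFun.measurable
  have := isFiniteMeasure_rieszMeasure c ha had
  have hchar (u : E) : Tendsto (fun T => charFun (rescaledMeasure F (D T) T) u) atTop
      (𝓝 (charFun (rieszMeasure E c a) u)) := by
    rw [charFun_rieszMeasure hc ha had]
    have hne : ∀ᵐ z : E, z + u ≠ 0 := by
      have : ∀ z : E, ¬ (z + u ≠ 0) ↔ z = -u := fun z => by
        rw [not_not, eq_neg_iff_add_eq_zero]
      simp [ae_iff, this, measure_singleton]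
    have h1 : Tendsto (fun T => ∫ z : E, besselKernel z * (B (T • (z + u)) / D T)) atTop
        (𝓝 (∫ z : E, besselKernel z * (c * ‖z + u‖ ^ (-a)))) := by
      refine tendsto_integral_filter_of_dominated_convergence
        (fun z => K * (besselKernel z * ‖z + u‖ ^ (-q) + besselKernel z)) ?_ ?_ ?_ ?_
      · refine Eventually.of_forall fun T => ?_
        refine (integrable_besselKernel (E := E)).aestronglyMeasurable.mul
          (Measurable.aestronglyMeasurable ?_)
        fun_prop
      · filter_upwards [eventually_ge_atTop T₀] with T hT
        filter_upwards [hne] with z hz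
        rw [norm_mul, Real.norm_of_nonneg (besselKernel_nonneg z), Real.norm_eq_abs]
        calc _ ≤ besselKernel z * (K * (‖z + u‖ ^ (-q) + 1)) :=
              mul_le_mul_of_nonneg_left (hbd T hT _ hz) (besselKernel_nonneg z)
          _ = _ := by ring
      · exact ((integrable_besselKernel_mul_rpow hq0 hq u).fun_add
          (integrable_besselKernel (E := E))).const_mul K
      · filter_upwards [hne] with z hz
        exact (hlim _ hz).const_mul _
    refine ((Complex.continuous_ofReal.tendsto _).comp h1).congr' ?_
    filter_upwards [eventually_gt_atTop 0] with T hT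
    rw [charFun_rescaledMeasure (hD T hT) T hF]
    rfl
  refine tendsto_of_seq_tendsto fun s hs => ?_
  exact tendsto_integral_of_tendsto_charFun (ν := fun k => rescaledMeasure F (D (s k)) (s k))
    (rieszMeasure_ne_zero hc ha had) (fun u => (hchar u).comp hs) g

lemma tendsto_measureReal_rescaledMeasure_univ {B : E → ℝ}
    (hF : ∀ z, charFun F z = (B z : ℂ))
    {D : ℝ → ℝ} (hD : ∀ T, 0 < T → 0 < D T) {K T₀ q : ℝ} (hq0 : 0 ≤ q)
    (hq : q < Module.finrank ℝ E)
    (hbd : ∀ T, T₀ ≤ T → ∀ z : E, z ≠ 0 → |B (T • z) / D T| ≤ K * (‖z‖ ^ (-q) + 1))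
    {c a : ℝ} (hc : 0 < c) (ha : 0 < a) (had : a < Module.finrank ℝ E)
    (hlim : ∀ z : E, z ≠ 0 →
      Tendsto (fun T => B (T • z) / D T) atTop (𝓝 (c * ‖z‖ ^ (-a)))) :
    Tendsto (fun T => (rescaledMeasure F (D T) T).real Set.univ) atTop
      (𝓝 ((rieszMeasure E c a).real Set.univ)) := by
  have h := tendsto_integral_rescaledMeasure hF hD hq0 hq hbd hc ha had hlim
    (BoundedContinuousFunction.const E 1)
  simp only [BoundedContinuousFunction.const_apply, integral_const, Complex.real_smul,
    mul_one] at h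
  exact_mod_cast (Complex.continuous_re.tendsto _).comp h

/-- Scaling limit of integrals of the symbol of the fractional kinetic equation: only the Riesz
part of the symbol survives. -/
theorem tendsto_integral_exp_symbol {B : E → ℝ} (hF : ∀ z, charFun F z = (B z : ℂ))
    {D : ℝ → ℝ} (hD : ∀ T, 0 < T → 0 < D T) {K T₀ q : ℝ} (hq0 : 0 ≤ q)
    (hq : q < Module.finrank ℝ E)
    (hbd : ∀ T, T₀ ≤ T → ∀ z : E, z ≠ 0 → |B (T • z) / D T| ≤ K * (‖z‖ ^ (-q) + 1))
    {c a : ℝ} (hc : 0 < c) (ha : 0 < a) (had : a < Module.finrank ℝ E)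
    (hlim : ∀ z : E, z ≠ 0 →
      Tendsto (fun T => B (T • z) / D T) atTop (𝓝 (c * ‖z‖ ^ (-a))))
    {A α γ : ℝ} (hA : 0 < A) (hα : 0 < α) (hγ : 0 ≤ γ) (v : E) :
    Tendsto (fun T => (((D T)⁻¹ : ℝ) : ℂ) * ∫ l, Complex.exp ((⟪l, T • v⟫ : ℝ) * Complex.I) *
        (Real.exp (-(A * ‖T • l‖ ^ α * (1 + ‖l‖ ^ 2) ^ (γ / 2))) : ℝ) ∂F) atTop
      (𝓝 (((c * tauberK (Module.finrank ℝ E) a : ℝ) : ℂ) *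
        ∫ l : E, Complex.exp ((⟪l, v⟫ : ℝ) * Complex.I) *
          ((Real.exp (-(A * ‖l‖ ^ α)) * ‖l‖ ^ (a - Module.finrank ℝ E) : ℝ) : ℂ))) := by
  have hwc : Continuous fun l : E => ((besselWeight l : ℝ) : ℂ)⁻¹ :=
    (Complex.continuous_ofReal.comp continuous_besselWeight).inv₀ fun l =>
      Complex.ofReal_ne_zero.2 (besselWeight_pos l).ne'
  have hrp : Continuous fun l : E => ‖l‖ ^ α :=
    Continuous.rpow_const continuous_norm fun _ => Or.inr hα.le
  set ψ : E → ℂ := fun l => ((besselWeight l : ℝ) : ℂ)⁻¹ *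
    (Complex.exp ((⟪l, v⟫ : ℝ) * Complex.I) * (Real.exp (-(A * ‖l‖ ^ α)) : ℝ)) with hψ
  set φ : ℝ → E → ℂ := fun T l => ((besselWeight l : ℝ) : ℂ)⁻¹ *
    (Complex.exp ((⟪l, v⟫ : ℝ) * Complex.I) *
      (Real.exp (-(A * ‖l‖ ^ α * (1 + (T⁻¹ * ‖l‖) ^ 2) ^ (γ / 2))) : ℝ)) with hφ
  have hψc : Continuous ψ := by
    refine hwc.mul (Continuous.mul (by fun_prop) ?_)
    exact Complex.continuous_ofReal.comp (Real.continuous_exp.comp (hrp.const_mul A).neg)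
  have hφc (T : ℝ) : Continuous (φ T) := by
    refine hwc.mul (Continuous.mul (by fun_prop) ?_)
    refine Complex.continuous_ofReal.comp (Real.continuous_exp.comp
      ((hrp.const_mul A).mul (Continuous.rpow_const (by fun_prop) fun l => Or.inr ?_)).neg)
    positivity
  have hwinv (l : E) :
      ‖((besselWeight l : ℝ) : ℂ)⁻¹‖ = (1 + ‖l‖ ^ 2) ^ (Module.finrank ℝ E : ℝ) := by
    rw [norm_inv, Complex.norm_real, Real.norm_of_nonneg (besselWeight_pos l).le, besselWeight,
      Real.rpow_neg (by positivity), inv_inv]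
  have hψb : ∃ C, ∀ l, ‖ψ l‖ ≤ C := by
    obtain ⟨C, hC⟩ := exists_one_add_sq_rpow_mul_exp_neg_le hA hα
      (Nat.cast_nonneg (Module.finrank ℝ E))
    refine ⟨C, fun l => ?_⟩
    rw [hψ, norm_mul, norm_mul, norm_cexp_inner_mul_I, one_mul, Complex.norm_real,
      Real.norm_of_nonneg (Real.exp_pos _).le, hwinv]
    exact hC _ (norm_nonneg l)
  obtain ⟨C₁, hC₁⟩ := hψb
  obtain ⟨C₂, hC₂0, hC₂⟩ := exists_bound_exp_symbol_sub hA hα hγ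
    (Nat.cast_nonneg (Module.finrank ℝ E))
  have hdiff (T : ℝ) (hT : 1 ≤ T) (l : E) : ‖φ T l - ψ l‖ ≤ C₂ * T⁻¹ ^ 2 := by
    have h1 := hC₂ T hT ‖l‖ (norm_nonneg l)
    rw [hφ, hψ]
    simp only
    rw [← mul_sub, ← mul_sub, norm_mul, norm_mul, norm_cexp_inner_mul_I, one_mul,
      ← Complex.ofReal_sub, Complex.norm_real, Real.norm_eq_abs, hwinv]
    have hb : (0 : ℝ) < 1 + ‖l‖ ^ 2 := by positivity
    calc _ ≤ (1 + ‖l‖ ^ 2) ^ (Module.finrank ℝ E : ℝ) *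
          (C₂ * T⁻¹ ^ 2 * (1 + ‖l‖ ^ 2) ^ (-(Module.finrank ℝ E : ℝ))) :=
          mul_le_mul_of_nonneg_left h1 (by positivity)
      _ = C₂ * T⁻¹ ^ 2 * ((1 + ‖l‖ ^ 2) ^ (Module.finrank ℝ E : ℝ) *
          (1 + ‖l‖ ^ 2) ^ (-(Module.finrank ℝ E : ℝ))) := by ring
      _ = C₂ * T⁻¹ ^ 2 := by rw [← Real.rpow_add hb]; simp
  have hmain := tendsto_integral_rescaledMeasure hF hD hq0 hq hbd hc ha had hlim
    (BoundedContinuousFunction.ofNormedAddCommGroup ψ hψc C₁ hC₁)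
  simp only [BoundedContinuousFunction.coe_ofNormedAddCommGroup] at hmain
  have hmass := tendsto_measureReal_rescaledMeasure_univ hF hD hq0 hq hbd hc ha had hlim
  have hψi (T : ℝ) : Integrable ψ (rescaledMeasure F (D T) T) :=
    Integrable.of_bound hψc.aestronglyMeasurable C₁ (ae_of_all _ hC₁)
  have hdi (T : ℝ) (hT : 1 ≤ T) :
      Integrable (fun l => φ T l - ψ l) (rescaledMeasure F (D T) T) :=
    Integrable.of_bound ((hφc T).sub hψc).aestronglyMeasurable _ (ae_of_all _ (hdiff T hT))
  have herr : Tendsto (fun T => ∫ l, (φ T l - ψ l) ∂(rescaledMeasure F (D T) T)) atTop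
      (𝓝 0) := by
    refine squeeze_zero_norm' (a := fun T => C₂ * T⁻¹ ^ 2 *
      (rescaledMeasure F (D T) T).real Set.univ) ?_ ?_
    · filter_upwards [eventually_ge_atTop 1] with T hT
      exact norm_integral_le_of_norm_le_const (ae_of_all _ (hdiff T hT))
    · have h0 := ((tendsto_inv_atTop_zero (𝕜 := ℝ)).pow 2).const_mul C₂
      simpa using h0.mul hmass
  have hsum := hmain.add herr
  rw [add_zero] at hsum
  have hlimeq : ∫ l, ψ l ∂(rieszMeasure E c a) =
      ((c * tauberK (Module.finrank ℝ E) a : ℝ) : ℂ) *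
        ∫ l : E, Complex.exp ((⟪l, v⟫ : ℝ) * Complex.I) *
          ((Real.exp (-(A * ‖l‖ ^ α)) * ‖l‖ ^ (a - Module.finrank ℝ E) : ℝ) : ℂ) := by
    rw [integral_rieszMeasure hc ha had]
    congr 1
    refine integral_congr_ae (ae_of_all _ fun l => ?_)
    have hw : ((besselWeight l : ℝ) : ℂ) ≠ 0 := by exact_mod_cast (besselWeight_pos l).ne'
    simp only [hψ, Complex.ofReal_mul]
    field_simp
  rw [← hlimeq]
  refine hsum.congr' ?_
  filter_upwards [eventually_ge_atTop 1] with T hT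
  have hT0 : 0 < T := by linarith
  rw [← integral_add (hψi T) (hdi T hT)]
  simp only [add_sub_cancel]
  rw [integral_rescaledMeasure (hD T hT0) T (hφc T)]
  congr 1
  refine integral_congr_ae (ae_of_all _ fun l => ?_)
  have hw : ((besselWeight (T • l) : ℝ) : ℂ) ≠ 0 := by
    exact_mod_cast (besselWeight_pos (T • l)).ne'
  simp only [hφ]
  rw [mul_inv_cancel_left₀ hw, real_inner_smul_left, real_inner_smul_right, norm_smul,
    Real.norm_of_nonneg hT0.le, inv_mul_cancel_left₀ hT0.ne']

end Rescaled

lemma hermiteNormalized_zero : hermiteNormalized 0 = fun _ => 1 := by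
  ext u
  simp [hermiteNormalized, hermiteFun]

/-- The spectral density of a unit variance field defines a probability measure whose
characteristic function is the covariance. -/
lemma exists_isProbabilityMeasure_charFun {E : Type*} [NormedAddCommGroup E]
    [InnerProductSpace ℝ E] [MeasurableSpace E] {V : Measure E} {R f : E → ℝ}
    (hf : Measurable f) (hf0 : ∀ l, 0 ≤ f l) (hfi : Integrable f V) (hR0 : R 0 = 1)
    (hRf : ∀ z, (R z : ℂ) =
      ∫ l, Complex.exp (Complex.I * ((⟪l, z⟫ : ℝ) : ℂ)) * (f l : ℂ) ∂V) :
    ∃ ν : Measure E, IsProbabilityMeasure ν ∧ ∀ z, charFun ν z = (R z : ℂ) := by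
  have hchar (z : E) : charFun (V.withDensity fun l => ENNReal.ofReal (f l)) z = (R z : ℂ) := by
    rw [charFun_apply, integral_withDensity_ofReal hf hf0, hRf]
    simp_rw [mul_comm]
  refine ⟨_, ?_, hchar⟩
  have := isFiniteMeasure_withDensity_ofReal hfi.2
  have h0 := hchar 0
  rw [charFun_zero, hR0] at h0
  rw [isProbabilityMeasure_iff_real]
  exact_mod_cast h0

lemma ite_zero_sq_nonneg (C : ℕ → ℝ) (k : ℕ) : 0 ≤ if k = 0 then 0 else C k ^ 2 := by
  split_ifs <;> positivity

lemma summable_ite_zero_sq {C : ℕ → ℝ} (hC : Summable fun k => C k ^ 2) :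
    Summable fun k => if k = 0 then 0 else C k ^ 2 := by
  refine Summable.of_nonneg_of_le (ite_zero_sq_nonneg C) (fun k => ?_) hC
  split_ifs
  · positivity
  · rfl

/-- The covariance of a nonlinear function of a stationary Gaussian field is, up to the squared
mean, the characteristic function of a finite measure. -/
lemma exists_spectral_measure_comp {E : Type*} [NormedAddCommGroup E]
    [InnerProductSpace ℝ E] [MeasurableSpace E] [BorelSpace E] [SecondCountableTopology E]
    {ν : Measure E} [IsProbabilityMeasure ν] {R : E → ℝ}
    (hν : ∀ z, charFun ν z = (R z : ℂ)) {C : ℕ → ℝ} (hC : Summable fun k => C k ^ 2)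
    {S : E → E → ℝ} (hS : ∀ x y, HasSum (fun k => C k ^ 2 * R (x - y) ^ k) (S x y)) :
    ∃ F : Measure E, IsFiniteMeasure F ∧
      (∀ z, charFun F z = ((∑' k, (if k = 0 then 0 else C k ^ 2) * R z ^ k : ℝ) : ℂ)) ∧
      ∀ x y, ((S x y : ℝ) : ℂ) = (C 0 ^ 2 : ℝ) + charFun F (x - y) := by
  obtain ⟨F, hFfin, hF⟩ := exists_measure_charFun_eq_tsum ν (ite_zero_sq_nonneg C)
    (summable_ite_zero_sq hC)
  have hF' (z : E) : charFun F z =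
      ((∑' k, (if k = 0 then 0 else C k ^ 2) * R z ^ k : ℝ) : ℂ) := by
    rw [hF, Complex.ofReal_tsum]
    simp_rw [hν, Complex.ofReal_mul, Complex.ofReal_pow]
  refine ⟨F, hFfin, hF', fun x y => ?_⟩
  have h1 := (hS x y).sub (hasSum_ite_eq 0 (C 0 ^ 2))
  have e (k : ℕ) : C k ^ 2 * R (x - y) ^ k - (if k = 0 then C 0 ^ 2 else 0) =
      (if k = 0 then 0 else C k ^ 2) * R (x - y) ^ k := by
    rcases eq_or_ne k 0 with rfl | hk
    · simp
    · simp [hk]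
  simp_rw [e] at h1
  rw [hF', h1.tsum_eq]
  push_cast
  ring

/-- Proposition 4, part (1) of the paper: the macro-scaling covariance limit for a
single fractional kinetic equation with subordinated-Gaussian long-range-dependent
initial data; only the Riesz parameter `α` survives in the limit. -/
theorem macro_scaling_covariance_limit
    (n : ℕ) (hn : 1 ≤ n) (μ α γ : ℝ)
    (hμ : 0 < μ) (hα : 0 < α) (hγ : 0 ≤ γ)
    {Ω : Type*} [MeasurableSpace Ω] {P : Measure Ω} [IsProbabilityMeasure P]
    (ζ : EuclideanSpace ℝ (Fin n) → Ω → ℝ)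
    (hζmeas : Measurable (fun pr : EuclideanSpace ℝ (Fin n) × Ω => ζ pr.1 pr.2))
    (hζGauss : ∀ (k : ℕ) (pts : Fin k → EuclideanSpace ℝ (Fin n)) (c : Fin k → ℝ),
      ∃ v : NNReal, Measure.map (fun ω => ∑ i, c i * ζ (pts i) ω) P = gaussianReal 0 v)
    (R : EuclideanSpace ℝ (Fin n) → ℝ)
    (hζvar : ∀ x, ∫ ω, (ζ x ω) ^ 2 ∂P = 1)
    (hζcov : ∀ x y, ∫ ω, ζ x ω * ζ y ω ∂P = R (x - y))
    (f : EuclideanSpace ℝ (Fin n) → ℝ)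
    (hfmeas : Measurable f) (hfnonneg : ∀ l, 0 ≤ f l) (hfint : Integrable f)
    (hfradial : ∀ l l' : EuclideanSpace ℝ (Fin n), ‖l‖ = ‖l'‖ → f l = f l')
    (lam0 : ℝ) (hlam0 : 0 < lam0)
    (hfdecr : ∀ l l' : EuclideanSpace ℝ (Fin n), lam0 < ‖l‖ → ‖l‖ ≤ ‖l'‖ → f l' ≤ f l)
    (hfcont : ∀ l : EuclideanSpace ℝ (Fin n), l ≠ 0 → ContinuousAt f l)
    (hRf : ∀ z, (↑(R z) : ℂ) = ∫ l, Complex.exp (Complex.I * ((⟪l, z⟫ : ℝ) : ℂ)) * ↑(f l))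
    (h : ℝ → ℝ) (hhmeas : Measurable h)
    (hhL2 : Integrable (fun u => (h u) ^ 2) (gaussianReal 0 1))
    (C : ℕ → ℝ)
    (hC : ∀ σ, C σ = ∫ u, h u * (hermiteFun σ u / Real.sqrt (σ.factorial))
      ∂(gaussianReal 0 1))
    (m : ℕ) (hm1 : 1 ≤ m) (hCm : C m ≠ 0) (hCσ : ∀ σ, 1 ≤ σ → σ < m → C σ = 0)
    (κ : ℝ) (hκ0 : 0 < κ) (hκn : (m : ℝ) * κ < n)
    (L : ℝ → ℝ) (hLpos : ∀ y > 0, 0 < L y) (hL : SlowlyVaryingAtTop L)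
    (hLbdd : ∀ M > 0, ∃ Cb, ∀ y ∈ Set.Ioc (0:ℝ) M, L y ≤ Cb)
    (hRasymp : Tendsto (fun z : EuclideanSpace ℝ (Fin n) => R z * ‖z‖ ^ κ / L ‖z‖)
      (Filter.comap norm Filter.atTop) (𝓝 1))
    (G : ℝ → EuclideanSpace ℝ (Fin n) → ℝ)
    (hGint : ∀ s > 0, Integrable (G s))
    (hGft : ∀ s > 0, ∀ l : EuclideanSpace ℝ (Fin n),
      ∫ y, Complex.exp (Complex.I * ((⟪y, l⟫ : ℝ) : ℂ)) * ↑(G s y)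
        = ↑(Real.exp (-(μ * s * ‖l‖ ^ α * (1 + ‖l‖ ^ 2) ^ (γ / 2)))))
    (sE : ℝ → ℝ → EuclideanSpace ℝ (Fin n) → Ω → ℝ)
    (hsE : ∀ ε t x ω, sE ε t x ω =
      (ε ^ ((m : ℝ) * κ / α) * L (ε ^ (-(1 / α))) ^ m) ^ (-(1 / 2) : ℝ) *
        ((∫ y, G (t / ε) y * h (ζ ((ε ^ (-(1 / α))) • x - y) ω)) - C 0))
    (t t' : ℝ) (ht : 0 < t) (ht' : 0 < t')
    (x x' : EuclideanSpace ℝ (Fin n)) :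
    Tendsto (fun ε : ℝ =>
        (↑((∫ ω, sE ε t x ω * sE ε t' x' ω ∂P)
          - (∫ ω, sE ε t x ω ∂P) * (∫ ω, sE ε t' x' ω ∂P)) : ℂ))
      (𝓝[>] 0)
      (𝓝 ((↑(C m ^ 2 * tauberK n ((m : ℝ) * κ)) : ℂ) *
        ∫ l : EuclideanSpace ℝ (Fin n),
          Complex.exp (Complex.I * ((⟪x - x', l⟫ : ℝ) : ℂ)) *
            ↑(Real.exp (-(μ * (t + t') * ‖l‖ ^ α)) *
              ‖l‖ ^ ((m : ℝ) * κ - (n : ℝ))))) := by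
  have : Nonempty (Fin n) := ⟨⟨0, hn⟩⟩
  have hdim : (Module.finrank ℝ (EuclideanSpace ℝ (Fin n)) : ℝ) = n := by
    rw [finrank_euclideanSpace_fin]
  have hR0 : R 0 = 1 := by
    rw [← sub_self (0 : EuclideanSpace ℝ (Fin n)), ← hζcov, ← hζvar 0]
    simp_rw [sq]
  obtain ⟨ν, hν, hνR⟩ := exists_isProbabilityMeasure_charFun hfmeas hfnonneg hfint hR0 hRf
  have hR1 (z : EuclideanSpace ℝ (Fin n)) : |R z| ≤ 1 := by
    rw [← Real.norm_eq_abs, ← Complex.norm_real, ← hνR]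
    exact norm_charFun_le_one z
  have hmem : MemLp h 2 (gaussianReal 0 1) :=
    (memLp_two_iff_integrable_sq hhmeas.aestronglyMeasurable).2 hhL2
  have hζ (x : EuclideanSpace ℝ (Fin n)) : Measurable (ζ x) :=
    hζmeas.comp (measurable_const.prodMk measurable_id)
  obtain ⟨hH2, hmean, hsq, hsum⟩ :=
    gaussianField_function_moments hζ hζGauss hζvar hζcov hhmeas hmem
  have hCs := summable_sq_hermite_coeff hmem
  have hC' (k : ℕ) : ∫ u, h u * hermiteNormalized k u ∂(gaussianReal 0 1) = C k := (hC k).symm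
  simp_rw [hC'] at hsum hCs
  have hC0 : ∫ u, h u ∂(gaussianReal 0 1) = C 0 := by
    rw [← hC' 0, hermiteNormalized_zero]
    simp_rw [mul_one]
  obtain ⟨F, hFfin, hFB, hFcov⟩ := exists_spectral_measure_comp hνR hCs hsum
  set c : ℕ → ℝ := fun k => if k = 0 then 0 else C k ^ 2 with hcdef
  have hc0 : ∀ k, 0 ≤ c k := ite_zero_sq_nonneg C
  have hcs : Summable c := summable_ite_zero_sq hCs
  have hcm : ∀ k < m, c k = 0 := fun k hk => by
    rcases eq_or_ne k 0 with rfl | hk0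
    · simp [hcdef]
    · simp [hcdef, hk0, hCσ k (Nat.one_le_iff_ne_zero.2 hk0) hk]
  have hcmC : c m = C m ^ 2 := if_neg (by omega)
  have hm0 : (0 : ℝ) < m := by exact_mod_cast hm1
  obtain ⟨δ, hδ, hδκ, hδn⟩ : ∃ δ : ℝ, 0 < δ ∧ δ ≤ κ ∧ (m : ℝ) * (κ + δ) < n := by
    refine ⟨min κ ((n - m * κ) / (2 * m)), lt_min hκ0 (by have := sub_pos.2 hκn; positivity),
      min_le_left _ _, ?_⟩
    have h1 : (m : ℝ) * min κ ((n - m * κ) / (2 * m)) ≤ m * ((n - m * κ) / (2 * m)) :=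
      mul_le_mul_of_nonneg_left (min_le_right _ _) hm0.le
    have h2 : (m : ℝ) * ((n - m * κ) / (2 * m)) = (n - m * κ) / 2 := by field_simp
    linarith
  obtain ⟨K, T₀, -, hbd⟩ :=
    exists_bound_rescaled_tsum hc0 hcs hcm hL hLpos hκ0 hR1 hRasymp hδ hδκ
  have hlim := tendsto_integral_exp_symbol (F := F) hFB
    (D := fun T => (T ^ (-κ) * L T) ^ m)
    (fun T hT => by have := hLpos T hT; positivity) (q := m * (κ + δ)) (by positivity)
    (by rwa [hdim]) hbd (c := c m) (a := m * κ)
    (by rw [hcmC]; positivity) (by positivity) (by rwa [hdim])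
    (fun z hz => tendsto_rescaled_tsum hc0 hcs hcm hL hLpos hκ0 hR1 hRasymp hz)
    (A := μ * (t + t')) (by positivity) hα hγ (x - x')
  have hT : Tendsto (fun ε : ℝ => ε ^ (-(1 / α))) (𝓝[>] 0) atTop :=
    tendsto_rpow_neg_nhdsGT_zero (neg_neg_of_pos (by positivity))
  rw [hdim, finrank_euclideanSpace_fin, hcmC] at hlim
  have hcomp := hlim.comp hT
  have elim (l : EuclideanSpace ℝ (Fin n)) : Complex.exp ((⟪l, x - x'⟫ : ℝ) * Complex.I) =
      Complex.exp (Complex.I * ((⟪x - x', l⟫ : ℝ) : ℂ)) := by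
    rw [mul_comm, real_inner_comm]
  simp_rw [elim] at hcomp
  refine hcomp.congr' ?_
  filter_upwards [self_mem_nhdsWithin] with ε hε
  have hε0 : 0 < ε := hε
  have hG1 (s : ℝ) (hs : 0 < s) : ∫ y, G s y = 1 := by
    have h0 := hGft s hs 0
    simp only [inner_zero_right, Complex.ofReal_zero, mul_zero, Complex.exp_zero, one_mul,
      norm_zero, Real.zero_rpow hα.ne', zero_mul, neg_zero, Real.exp_zero,
      Complex.ofReal_one] at h0
    rw [integral_complex_ofReal] at h0
    exact_mod_cast h0
  have hs : 0 < t / ε := div_pos ht hε0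
  have hs' : 0 < t' / ε := div_pos ht' hε0
  set T : ℝ := ε ^ (-(1 / α)) with hTdef
  have hT0 : 0 < T := Real.rpow_pos_of_pos hε0 _
  have hLT := hLpos T hT0
  have hTα : T ^ α = ε⁻¹ := by
    rw [hTdef, ← Real.rpow_mul hε0.le, neg_mul, one_div_mul_cancel hα.ne', Real.rpow_neg_one]
  have hD : ε ^ ((m : ℝ) * κ / α) * L T ^ m = (T ^ (-κ) * L T) ^ m := by
    rw [mul_pow, hTdef, ← Real.rpow_mul hε0.le, ← Real.rpow_natCast (ε ^ _) m,
      ← Real.rpow_mul hε0.le]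
    congr 2
    field_simp
  have hDpos : 0 < (T ^ (-κ) * L T) ^ m := by positivity
  have hr : (((T ^ (-κ) * L T) ^ m) ^ (-(1 / 2) : ℝ)) ^ 2 = ((T ^ (-κ) * L T) ^ m)⁻¹ := by
    rw [← Real.rpow_natCast (_ ^ (-(1 / 2) : ℝ)) 2, ← Real.rpow_mul hDpos.le]
    norm_num [Real.rpow_neg_one]
  have hcov := covariance_convolution_eq_integral_spectral (P := P)
    (H := fun y ω => h (ζ y ω)) (hhmeas.comp hζmeas) hH2 (fun y => (hsq y).le)
    (fun y => (hmean y).trans hC0) (F := F) hFcov (hGint _ hs) (hGint _ hs') (hG1 _ hs)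
    (hG1 _ hs') (((T ^ (-κ) * L T) ^ m) ^ (-(1 / 2) : ℝ)) (T • x) (T • x')
  simp only [hsE, ← hTdef, hD, Function.comp_apply]
  rw [hcov, hr]
  congr 1
  refine integral_congr_ae (ae_of_all _ fun l => ?_)
  simp only
  rw [hGft _ hs, hGft _ hs', smul_sub, ← Complex.ofReal_mul, ← Real.exp_add, norm_neg,
    norm_smul, Real.norm_of_nonneg hT0.le, Real.mul_rpow hT0.le (norm_nonneg l), hTα]
  congr 4
  field_simp
  ring
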